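/- arXiv:1606.04747 — 4 statements merged into one kernel-verified Lean document; each statement's English description precedes it below -/
import Mathlib

section
/- Let p ≥ 1 be an integer and let Σ be a real symmetric positive definite p × p matrix. For every real α > 0 such that 2α is a positive integer or 2α > ⌊(p−1)/2⌋ (the integer part of (p−1)/2), there exists a probability measure μ on ℝ^p, supported on the nonnegative orthant [0,∞)^p, such that for every t ∈ ℝ^p with all coordinates t_j ≥ 0, ∫ exp(−∑_{j=1}^p t_j x_j) dμ(x) = det(I_p + Σ·diag(t_1,…,t_p))^{−α}. -/
open MeasureTheory Matrix

/-- `F` lies in the cone dual to the finite combinations of the functions `E t` (`t ∈ P`) that are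
nonnegative on `D`. For exponential kernels this is a finitary substitute for being the Laplace
transform of a positive measure on `D`. -/
def KernelPositive {τ χ : Type*} (E : τ → χ → ℝ) (P : Set τ) (D : Set χ) (F : τ → ℝ) : Prop :=
  ∀ (ι : Type) (s : Finset ι) (c : ι → ℝ) (t : ι → τ), (∀ i, t i ∈ P) →
    (∀ x ∈ D, 0 ≤ ∑ i ∈ s, c i * E (t i) x) → 0 ≤ ∑ i ∈ s, c i * F (t i)

namespace KernelPositive

variable {τ τ' χ χ' : Type*} {E : τ → χ → ℝ} {P : Set τ} {D D' : Set χ} {F G : τ → ℝ}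

theorem of_mem {x : χ} (hx : x ∈ D) : KernelPositive E P D (fun t => E t x) :=
  fun _ _ _ _ _ h => h x hx

theorem congr (hF : KernelPositive E P D F) (h : ∀ t ∈ P, F t = G t) :
    KernelPositive E P D G := by
  intro ι s c t ht hc
  simpa only [h _ (ht _)] using hF ι s c t ht hc

theorem mono (hF : KernelPositive E P D F) (h : D ⊆ D') : KernelPositive E P D' F :=
  fun ι s c t ht hc => hF ι s c t ht fun x hx => hc x (h hx)

theorem const_mul (hF : KernelPositive E P D F) {a : ℝ} (ha : 0 ≤ a) :
    KernelPositive E P D (fun t => a * F t) := by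
  intro ι s c t ht hc
  have := mul_nonneg ha (hF ι s c t ht hc)
  rw [Finset.mul_sum] at this
  refine this.trans_eq (Finset.sum_congr rfl fun i _ => by ring)

theorem integral {Ω : Type*} [MeasurableSpace Ω] {μ : Measure Ω} {F : Ω → τ → ℝ}
    (hF : ∀ᵐ ω ∂μ, KernelPositive E P D (F ω))
    (hint : ∀ t ∈ P, Integrable (fun ω => F ω t) μ) :
    KernelPositive E P D (fun t => ∫ ω, F ω t ∂μ) := by
  intro ι s c t ht hc
  have : ∑ i ∈ s, c i * ∫ ω, F ω (t i) ∂μ = ∫ ω, ∑ i ∈ s, c i * F ω (t i) ∂μ := by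
    rw [integral_finsetSum _ fun i _ => (hint _ (ht i)).const_mul _]
    simp only [integral_const_mul]
  rw [this]
  refine integral_nonneg_of_ae ?_
  filter_upwards [hF] with ω hω using hω ι s c t ht hc

theorem hasSum {F : ℕ → τ → ℝ} (hF : ∀ k, KernelPositive E P D (F k))
    (hG : ∀ t ∈ P, HasSum (fun k => F k t) (G t)) : KernelPositive E P D G := by
  intro ι s c t ht hc
  have : HasSum (fun k => ∑ i ∈ s, c i * F k (t i)) (∑ i ∈ s, c i * G (t i)) :=
    hasSum_sum fun i _ => (hG _ (ht i)).mul_left _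
  exact this.nonneg fun k => hF k ι s c t ht hc

/-- Composition with a family of functions indexed by the space on which `F` is positive. -/
theorem comp {E' : τ' → χ' → ℝ} {P' : Set τ'} {D' : Set χ'} {F : τ' → ℝ} {g : τ → ℝ}
    {φ : τ → τ'} (hF : KernelPositive E' P' D' F) (hφ : ∀ t ∈ P, φ t ∈ P')
    (h : ∀ x ∈ D', KernelPositive E P D (fun t => g t * E' (φ t) x)) :
    KernelPositive E P D (fun t => g t * F (φ t)) := by
  intro ι s c t ht hc
  have := hF ι s (fun i => c i * g (t i)) (fun i => φ (t i)) (fun i => hφ _ (ht i)) fun x hx => by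
    simpa only [mul_assoc] using h x hx ι s c t ht hc
  simpa only [mul_assoc] using this

theorem mul (hE : ∀ x ∈ D, ∀ y ∈ D, ∃ z ∈ D, ∀ t ∈ P, E t x * E t y = E t z)
    (hF : KernelPositive E P D F) (hG : KernelPositive E P D G) :
    KernelPositive E P D (fun t => F t * G t) := by
  refine hG.comp (φ := id) (fun _ h => h) fun x hx => ?_
  refine (hF.comp (g := fun t => E t x) (φ := id) (fun _ h => h) fun y hy => ?_).congr
    fun t _ => mul_comm _ _
  obtain ⟨z, hz, h⟩ := hE x hx y hy
  exact (of_mem hz).congr fun t ht => (h t ht).symm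

theorem one (hE : ∃ x ∈ D, ∀ t ∈ P, E t x = 1) : KernelPositive E P D (fun _ => 1) := by
  obtain ⟨x, hx, h⟩ := hE
  exact (of_mem hx).congr h

theorem prod (h1 : ∃ x ∈ D, ∀ t ∈ P, E t x = 1)
    (hE : ∀ x ∈ D, ∀ y ∈ D, ∃ z ∈ D, ∀ t ∈ P, E t x * E t y = E t z)
    {κ : Type*} (K : Finset κ) {F : κ → τ → ℝ} (hF : ∀ k ∈ K, KernelPositive E P D (F k)) :
    KernelPositive E P D (fun t => ∏ k ∈ K, F k t) := by
  classical
  induction K using Finset.induction_on with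
  | empty => simpa using one h1
  | insert a K ha ih =>
    simp only [Finset.prod_insert ha]
    exact mul hE (hF a (by simp)) (ih fun k hk => hF k (by simp [hk]))

end KernelPositive

/-- The matrix Laplace kernel `exp (-tr (T X))`. -/
noncomputable def expTrace {n : Type*} [Fintype n] (T X : Matrix n n ℝ) : ℝ :=
  Real.exp (-(T * X).trace)

section ExpTrace

variable {n : Type*} [Fintype n]

theorem expTrace_add (T X Y : Matrix n n ℝ) :
    expTrace T (X + Y) = expTrace T X * expTrace T Y := by
  simp only [expTrace, mul_add, trace_add, ← Real.exp_add]
  congr 1; ring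

theorem expTrace_zero (T : Matrix n n ℝ) : expTrace T 0 = 1 := by simp [expTrace]

theorem expTrace_sum (T : Matrix n n ℝ) {κ : Type*} (K : Finset κ) (X : κ → Matrix n n ℝ) :
    expTrace T (∑ k ∈ K, X k) = ∏ k ∈ K, expTrace T (X k) := by
  classical
  induction K using Finset.induction_on with
  | empty => simp [expTrace_zero]
  | insert a K ha ih => rw [Finset.sum_insert ha, Finset.prod_insert ha, expTrace_add, ih]

theorem trace_mul_vecMulVec (T : Matrix n n ℝ) (x : n → ℝ) :
    (T * vecMulVec x x).trace = x ⬝ᵥ T *ᵥ x := by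
  rw [mul_vecMulVec, trace_vecMulVec, dotProduct_comm]

/-- Symmetric positive semidefinite matrices of rank at most one. -/
def rankOneCone (n : Type*) : Set (Matrix n n ℝ) := Set.range fun m : n → ℝ => vecMulVec m m

theorem rankOneCone_subset : rankOneCone n ⊆ {X | X.PosSemidef} := by
  rintro _ ⟨m, rfl⟩
  simpa using posSemidef_vecMulVec_self_star m

theorem quadForm_nonneg {T : Matrix n n ℝ} (hT : T.PosSemidef) (x : n → ℝ) :
    0 ≤ x ⬝ᵥ T *ᵥ x := by
  simpa using hT.dotProduct_mulVec_nonneg x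

theorem quadForm_comm {T : Matrix n n ℝ} (hT : T.PosSemidef) (x y : n → ℝ) :
    x ⬝ᵥ T *ᵥ y = y ⬝ᵥ T *ᵥ x := by
  have : Tᵀ = T := by simpa using hT.isHermitian.eq
  rw [dotProduct_mulVec, ← mulVec_transpose, this, dotProduct_comm]

theorem quadForm_add_smul {T : Matrix n n ℝ} (hT : T.PosSemidef) (m s : n → ℝ) (z : ℝ) :
    (m + z • s) ⬝ᵥ T *ᵥ (m + z • s) =
      m ⬝ᵥ T *ᵥ m + 2 * (s ⬝ᵥ T *ᵥ m) * z + (s ⬝ᵥ T *ᵥ s) * z ^ 2 := by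
  simp only [mulVec_add, mulVec_smul, dotProduct_add, add_dotProduct, smul_dotProduct,
    dotProduct_smul, smul_eq_mul, quadForm_comm hT m s]
  ring

end ExpTrace

theorem exp_quadratic_eq {q a b : ℝ} (hq : 0 < q) (z : ℝ) :
    Real.exp (-(a + 2 * b * z + q * z ^ 2)) =
      Real.exp (-a + b ^ 2 / q) * Real.exp (-q * (z + b / q) ^ 2) := by
  rw [← Real.exp_add]
  congr 1
  field_simp
  ring

theorem integrable_exp_quadratic {q : ℝ} (hq : 0 < q) (a b : ℝ) :
    Integrable fun z : ℝ => Real.exp (-(a + 2 * b * z + q * z ^ 2)) := by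
  simp only [exp_quadratic_eq hq]
  exact ((integrable_exp_neg_mul_sq hq).comp_add_right (b / q)).const_mul _

theorem integral_exp_quadratic {q : ℝ} (hq : 0 < q) (a b : ℝ) :
    ∫ z : ℝ, Real.exp (-(a + 2 * b * z + q * z ^ 2)) =
      √Real.pi * (q ^ (-(1 / 2) : ℝ) * Real.exp (-a + b ^ 2 / q)) := by
  simp only [exp_quadratic_eq hq]
  rw [integral_const_mul, integral_add_right_eq_self (fun z => Real.exp (-q * z ^ 2)),
    integral_gaussian, Real.sqrt_div Real.pi_pos.le, Real.rpow_neg hq.le, ← Real.sqrt_eq_rpow]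
  ring

section RankOne

variable {n : Type*} [Fintype n]

theorem kernelPositive_gaussian (s m : n → ℝ) :
    KernelPositive expTrace {T | T.PosSemidef} (rankOneCone n) fun T =>
      (1 + s ⬝ᵥ T *ᵥ s) ^ (-(1 / 2) : ℝ) *
        Real.exp (-(m ⬝ᵥ T *ᵥ m) + (s ⬝ᵥ T *ᵥ m) ^ 2 / (1 + s ⬝ᵥ T *ᵥ s)) := by
  have key : ∀ T : Matrix n n ℝ, T.PosSemidef → ∀ z : ℝ,
      Real.exp (-z ^ 2) * expTrace T (vecMulVec (m + z • s) (m + z • s)) =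
        Real.exp (-(m ⬝ᵥ T *ᵥ m + 2 * (s ⬝ᵥ T *ᵥ m) * z + (1 + s ⬝ᵥ T *ᵥ s) * z ^ 2)) := by
    intro T hT z
    rw [expTrace, trace_mul_vecMulVec, quadForm_add_smul hT, ← Real.exp_add]
    congr 1; ring
  have hpos : ∀ T : Matrix n n ℝ, T.PosSemidef → 0 < 1 + s ⬝ᵥ T *ᵥ s := fun T hT => by
    have := quadForm_nonneg hT s
    linarith
  refine ((KernelPositive.integral (μ := volume) (F := fun (z : ℝ) T =>
    Real.exp (-z ^ 2) * expTrace T (vecMulVec (m + z • s) (m + z • s)))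
    (.of_forall fun z => (KernelPositive.of_mem (D := rankOneCone n)
      ⟨m + z • s, rfl⟩).const_mul
      (Real.exp_pos _).le)
    fun T hT => ?_).const_mul (inv_nonneg.2 (Real.sqrt_nonneg Real.pi))).congr fun T hT => ?_
  · simp only [key T hT]
    exact integrable_exp_quadratic (hpos T hT) _ _
  · simp only [key T hT]
    rw [integral_exp_quadratic (hpos T hT), inv_mul_cancel_left₀ (by positivity)]

theorem kernelPositive_gamma (s : n → ℝ) {γ : ℝ} (hγ : 0 < γ) :
    KernelPositive expTrace {T | T.PosSemidef} {X | X.PosSemidef} fun T =>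
      (1 + s ⬝ᵥ T *ᵥ s) ^ (-γ) := by
  have key : ∀ T : Matrix n n ℝ, ∀ x : ℝ,
      x ^ (γ - 1) * Real.exp (-x) * expTrace T (x • vecMulVec s s) =
        x ^ (γ - 1) * Real.exp (-((1 + s ⬝ᵥ T *ᵥ s) * x)) := by
    intro T x
    rw [expTrace, Matrix.mul_smul, trace_smul, trace_mul_vecMulVec, mul_assoc, ← Real.exp_add,
      smul_eq_mul]
    congr 2; ring
  have hpos : ∀ T : Matrix n n ℝ, T.PosSemidef → 0 < 1 + s ⬝ᵥ T *ᵥ s := fun T hT => by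
    have := quadForm_nonneg hT s
    linarith
  refine ((KernelPositive.integral (μ := volume.restrict (Set.Ioi (0 : ℝ))) (F := fun (x : ℝ) T =>
    x ^ (γ - 1) * Real.exp (-x) * expTrace T (x • vecMulVec s s)) ?_
    fun T hT => ?_).const_mul (inv_nonneg.2 (Real.Gamma_pos_of_pos hγ).le)).congr fun T hT => ?_
  · refine (ae_restrict_mem measurableSet_Ioi).mono fun x hx => ?_
    have hx' : 0 ≤ x := le_of_lt hx
    refine (KernelPositive.of_mem ?_).const_mul (by positivity)
    exact (rankOneCone_subset ⟨s, rfl⟩).smul hx'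
  · simp only [key T]
    have := integrableOn_rpow_mul_exp_neg_mul_rpow (p := 1) (s := γ - 1) (b := 1 + s ⬝ᵥ T *ᵥ s)
      (by linarith) one_pos (hpos T hT)
    simpa only [IntegrableOn, Real.rpow_one, neg_mul] using this
  · simp only [key T]
    have h := hpos T hT
    rw [Real.integral_rpow_mul_exp_neg_mul_Ioi hγ h, mul_comm _ (Real.Gamma γ),
      inv_mul_cancel_left₀ (Real.Gamma_pos_of_pos hγ).ne', one_div, Real.inv_rpow h.le,
      Real.rpow_neg h.le]

theorem kernelPositive_noncentralGamma (s : n → ℝ) {β δ : ℝ} (hβ : 0 < β) (hδ : 0 ≤ δ) :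
    KernelPositive expTrace {T | T.PosSemidef} {X | X.PosSemidef} fun T =>
      (1 + s ⬝ᵥ T *ᵥ s) ^ (-β) *
        Real.exp (δ * (-(s ⬝ᵥ T *ᵥ s) + (s ⬝ᵥ T *ᵥ s) ^ 2 / (1 + s ⬝ᵥ T *ᵥ s))) := by
  refine (KernelPositive.hasSum (F := fun k T =>
    (Real.exp (-δ) * (δ ^ k / k.factorial)) * (1 + s ⬝ᵥ T *ᵥ s) ^ (-(β + k)))
    (fun k => (kernelPositive_gamma s (by positivity)).const_mul (by positivity))
    fun T hT => ?_)
  have hq : 0 < 1 + s ⬝ᵥ T *ᵥ s := by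
    have := quadForm_nonneg hT s
    linarith
  have h := (NormedSpace.expSeries_div_hasSum_exp (δ / (1 + s ⬝ᵥ T *ᵥ s))).mul_left
    (Real.exp (-δ) * (1 + s ⬝ᵥ T *ᵥ s) ^ (-β))
  convert! h using 1
  · ext k
    rw [neg_add, Real.rpow_add hq, Real.rpow_neg hq.le (k : ℝ), Real.rpow_natCast, div_pow]
    field_simp
  · rw [← Real.exp_eq_exp_ℝ, mul_right_comm, ← Real.exp_add, mul_comm]
    congr 2
    field_simp
    ring

end RankOne

section Wishart

variable {n : Type*} [Fintype n] [DecidableEq n]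

open scoped MatrixOrder in
theorem exists_eq_conjTranspose_mul_self {S : Matrix n n ℝ} (hS : S.PosSemidef) :
    ∃ R : Matrix n n ℝ, S = Rᴴ * R :=
  CStarAlgebra.nonneg_iff_eq_star_mul_self.mp hS.nonneg

theorem one_add_mul_det_pos {S T : Matrix n n ℝ} (hS : S.PosSemidef) (hT : T.PosSemidef) :
    0 < (1 + S * T).det := by
  obtain ⟨R, rfl⟩ := exists_eq_conjTranspose_mul_self hS
  rw [mul_assoc, det_one_add_mul_comm]
  exact (PosDef.one.add_posSemidef (hT.mul_mul_conjTranspose_same R)).det_pos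

theorem posSemidef_mul_inv_one_add_mul {S T : Matrix n n ℝ} (hS : S.PosSemidef)
    (hT : T.PosSemidef) : (T * (1 + S * T)⁻¹).PosSemidef := by
  have hu : IsUnit (1 + S * T).det := (one_add_mul_det_pos hS hT).ne'.isUnit
  have h : (T + T * S * T).PosSemidef := by
    have := hT.add (hS.conjTranspose_mul_mul_same T)
    rwa [hT.isHermitian.eq] at this
  have := h.conjTranspose_mul_mul_same (1 + S * T)⁻¹
  convert! this using 1
  have e : T + T * S * T = (1 + S * T)ᴴ * T := by
    rw [conjTranspose_add, conjTranspose_mul, hT.isHermitian.eq, hS.isHermitian.eq]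
    simp [add_mul]
  rw [e, ← mul_assoc, conjTranspose_nonsing_inv,
    nonsing_inv_mul _ (by rw [det_conjTranspose]; exact hu.star), one_mul]

/-- The Laplace transform of the noncentral Wishart distribution with `2 * α` degrees of freedom,
scale `S` and noncentrality `Δ` (up to constant factors in the scale). -/
noncomputable def wishartTransform (α : ℝ) (S Δ T : Matrix n n ℝ) : ℝ :=
  (1 + S * T).det ^ (-α) * expTrace (T * (1 + S * T)⁻¹) Δ

theorem wishartTransform_zero_scale (α : ℝ) (Δ T : Matrix n n ℝ) :
    wishartTransform α 0 Δ T = expTrace T Δ := by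
  simp [wishartTransform]

theorem wishartTransform_zero (α : ℝ) (S T : Matrix n n ℝ) :
    wishartTransform α S 0 T = (1 + S * T).det ^ (-α) := by
  simp [wishartTransform, expTrace_zero]

theorem wishartTransform_add (α : ℝ) {R S T : Matrix n n ℝ} (Δ : Matrix n n ℝ)
    (hR : R.PosSemidef) (hS : S.PosSemidef) (hT : T.PosSemidef) :
    wishartTransform α (R + S) Δ T =
      (1 + S * T).det ^ (-α) * wishartTransform α R Δ (T * (1 + S * T)⁻¹) := by
  have hd := one_add_mul_det_pos hS hT
  have hu : IsUnit (1 + S * T).det := hd.ne'.isUnit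
  have e : 1 + R * (T * (1 + S * T)⁻¹) = (1 + (R + S) * T) * (1 + S * T)⁻¹ := by
    rw [add_mul R, add_comm (R * T), ← add_assoc, add_mul _ (R * T), mul_nonsing_inv _ hu,
      mul_assoc]
  have hd' := one_add_mul_det_pos hR (posSemidef_mul_inv_one_add_mul hS hT)
  rw [wishartTransform, wishartTransform, ← mul_assoc, ← Real.mul_rpow hd.le hd'.le, e, det_mul,
    mul_comm (det (1 + S * T)), mul_assoc, ← det_mul, nonsing_inv_mul _ hu, det_one, mul_one,
    Matrix.mul_inv_rev, nonsing_inv_nonsing_inv _ hu, mul_assoc T, ← mul_assoc _ (1 + S * T),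
    nonsing_inv_mul _ hu, one_mul]

theorem det_one_add_vecMulVec_mul (s : n → ℝ) (T : Matrix n n ℝ) :
    (1 + vecMulVec s s * T).det = 1 + s ⬝ᵥ T *ᵥ s := by
  rw [vecMulVec_mul, vecMulVec_eq Unit, det_one_add_replicateCol_mul_replicateRow,
    ← dotProduct_mulVec]

theorem mul_inv_one_add_vecMulVec_mul (s : n → ℝ) {T : Matrix n n ℝ} (hT : T.PosSemidef) :
    T * (1 + vecMulVec s s * T)⁻¹ =
      T - (1 + s ⬝ᵥ T *ᵥ s)⁻¹ • vecMulVec (T *ᵥ s) (T *ᵥ s) := by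
  have hs : (vecMulVec s s).PosSemidef := rankOneCone_subset ⟨s, rfl⟩
  have hd := one_add_mul_det_pos hs hT
  have hu : IsUnit (1 + vecMulVec s s * T).det := hd.ne'.isUnit
  rw [det_one_add_vecMulVec_mul] at hd
  have hTs : s ᵥ* T = T *ᵥ s := by
    have : Tᵀ = T := by simpa using hT.isHermitian.eq
    rw [← mulVec_transpose, this]
  have e : T = (T - (1 + s ⬝ᵥ T *ᵥ s)⁻¹ • vecMulVec (T *ᵥ s) (T *ᵥ s)) *
      (1 + vecMulVec s s * T) := by
    rw [vecMulVec_mul, hTs, mul_add, mul_one, sub_mul, mul_vecMulVec, Matrix.smul_mul,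
      vecMulVec_mul_vecMulVec, dotProduct_comm (T *ᵥ s) s]
    have e1 : vecMulVec (T *ᵥ s) ((s ⬝ᵥ T *ᵥ s) • T *ᵥ s) =
        (s ⬝ᵥ T *ᵥ s) • vecMulVec (T *ᵥ s) (T *ᵥ s) := by
      ext i j
      simp only [vecMulVec_apply, Matrix.smul_apply, Pi.smul_apply, smul_eq_mul]; ring
    rw [e1, smul_smul]
    have : (1 + s ⬝ᵥ T *ᵥ s)⁻¹ * (s ⬝ᵥ T *ᵥ s) = 1 - (1 + s ⬝ᵥ T *ᵥ s)⁻¹ := by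
      field_simp; ring
    rw [this, sub_smul, one_smul]
    abel
  calc T * (1 + vecMulVec s s * T)⁻¹
      = (T - (1 + s ⬝ᵥ T *ᵥ s)⁻¹ • vecMulVec (T *ᵥ s) (T *ᵥ s)) *
        (1 + vecMulVec s s * T) * (1 + vecMulVec s s * T)⁻¹ := congrArg (· * _) e
    _ = _ := by rw [mul_assoc, mul_nonsing_inv _ hu, mul_one]

theorem expTrace_rankOne (s m : n → ℝ) {T : Matrix n n ℝ} (hT : T.PosSemidef) :
    expTrace (T * (1 + vecMulVec s s * T)⁻¹) (vecMulVec m m) =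
      Real.exp (-(m ⬝ᵥ T *ᵥ m) + (s ⬝ᵥ T *ᵥ m) ^ 2 / (1 + s ⬝ᵥ T *ᵥ s)) := by
  rw [expTrace, mul_inv_one_add_vecMulVec_mul s hT, trace_mul_vecMulVec, sub_mulVec, smul_mulVec,
    vecMulVec_mulVec, dotProduct_sub, dotProduct_smul, quadForm_comm hT s m]
  congr 1
  simp [dotProduct_smul, dotProduct_comm (T *ᵥ s) m]
  ring

/-- A noncentral Wishart transform is positive for every scale once it is for rank-one scales. -/
theorem kernelPositive_wishartTransform {α : ℝ} {D : Set (Matrix n n ℝ)}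
    (h : ∀ s : n → ℝ, ∀ Δ ∈ D, KernelPositive expTrace {T | T.PosSemidef} D
      (wishartTransform α (vecMulVec s s) Δ))
    {S : Matrix n n ℝ} (hS : S.PosSemidef) {Δ : Matrix n n ℝ} (hΔ : Δ ∈ D) :
    KernelPositive expTrace {T | T.PosSemidef} D (wishartTransform α S Δ) := by
  have hv : ∀ s : n → ℝ, (vecMulVec s s).PosSemidef := fun s => rankOneCone_subset ⟨s, rfl⟩
  obtain ⟨R, rfl⟩ := exists_eq_conjTranspose_mul_self hS
  have e : Rᴴ * R = ∑ k, vecMulVec (R.row k) (R.row k) := by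
    ext i j
    simp [Matrix.mul_apply, Matrix.sum_apply, vecMulVec_apply]
  rw [e]
  have : ∀ K : Finset n, KernelPositive expTrace {T | T.PosSemidef} D
      (wishartTransform α (∑ k ∈ K, vecMulVec (R.row k) (R.row k)) Δ) := by
    intro K
    induction K using Finset.induction_on with
    | empty =>
      exact (KernelPositive.of_mem hΔ).congr fun T _ => by
        rw [Finset.sum_empty, wishartTransform_zero_scale]
    | insert a K ha ih =>
      refine (ih.comp (g := fun T => (1 + vecMulVec (R.row a) (R.row a) * T).det ^ (-α))
        (φ := fun T => T * (1 + vecMulVec (R.row a) (R.row a) * T)⁻¹)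
        (fun T hT => posSemidef_mul_inv_one_add_mul (hv _) hT) fun X hX => h (R.row a) X hX).congr
        fun T hT => ?_
      rw [Finset.sum_insert ha, add_comm (vecMulVec _ _),
        wishartTransform_add α Δ (posSemidef_sum _ fun k _ => hv _) (hv _) hT]
  exact this _

theorem kernelPositive_wishartTransform_half {S : Matrix n n ℝ} (hS : S.PosSemidef)
    {Δ : Matrix n n ℝ} (hΔ : Δ ∈ rankOneCone n) :
    KernelPositive expTrace {T | T.PosSemidef} (rankOneCone n) (wishartTransform (1 / 2) S Δ) := by
  refine kernelPositive_wishartTransform ?_ hS hΔ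
  rintro s _ ⟨m, rfl⟩
  refine (kernelPositive_gaussian s m).congr fun T hT => ?_
  rw [wishartTransform, det_one_add_vecMulVec_mul, expTrace_rankOne s m hT]

/-- A positive semidefinite matrix is a sum of rank-one terms, one of which lies along a prescribed
nonzero vector. -/
theorem exists_rankOne_decomposition {Δ : Matrix n n ℝ} (hΔ : Δ.PosSemidef) {s : n → ℝ}
    (hs : s ≠ 0) : ∃ (m : n → n → ℝ) (δ : ℝ) (i₀ : n), 0 ≤ δ ∧
      Δ = δ • vecMulVec s s + ∑ k ∈ Finset.univ.erase i₀, vecMulVec (m k) (m k) := by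
  obtain ⟨R, hR⟩ := exists_eq_conjTranspose_mul_self hΔ
  obtain ⟨i₀, -⟩ := Function.ne_iff.1 hs
  let f : (n → ℝ) × ℝ →ₗ[ℝ] (n → ℝ) :=
    (Matrix.mulVecLin Rᵀ).coprod (-(LinearMap.toSpanSingleton ℝ (n → ℝ) s))
  obtain ⟨⟨u, r⟩, hur, hne⟩ : ∃ x ∈ LinearMap.ker f, x ≠ 0 := by
    refine (Submodule.ne_bot_iff _).1 (LinearMap.ker_ne_bot_of_finrank_lt ?_)
    simp
  have hu : Rᵀ *ᵥ u = r • s := by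
    have : Rᵀ *ᵥ u + -(r • s) = 0 := by
      rw [mulVec_transpose]; simpa [f] using hur
    exact add_neg_eq_zero.1 this
  have hu0 : WithLp.toLp 2 u ≠ 0 := by
    intro h0
    have h0' : u = 0 := by simpa using h0
    have : r • s = 0 := by rw [← hu, h0', mulVec_zero]
    rcases smul_eq_zero.1 this with h | h
    · exact hne (by rw [h0', h]; rfl)
    · exact hs h
  set e : EuclideanSpace ℝ n := (‖WithLp.toLp 2 u‖⁻¹ : ℝ) • WithLp.toLp 2 u with he
  have hen : ‖e‖ = 1 := by
    rw [he]; exact norm_smul_inv_norm hu0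
  obtain ⟨b, hb⟩ := Orthonormal.exists_orthonormalBasis_extension_of_card_eq (𝕜 := ℝ)
    (E := EuclideanSpace ℝ n) (ι := n) (by simp) (v := fun _ => e) (s := {i₀})
    ⟨fun _ => hen, fun i j hij => (hij (Subsingleton.elim _ _)).elim⟩
  have hb0 : b i₀ = e := hb i₀ rfl
  have hsum : ∑ k, vecMulVec (b k : n → ℝ) (b k) = 1 := by
    ext i j
    have := b.sum_inner_mul_inner (EuclideanSpace.single i (1 : ℝ))
      (EuclideanSpace.single j (1 : ℝ))
    simp only [EuclideanSpace.inner_single_left, EuclideanSpace.inner_single_right, map_one,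
      one_mul, conj_trivial] at this
    simp [Matrix.sum_apply, vecMulVec_apply, this, Matrix.one_apply, eq_comm]
  refine ⟨fun k => Rᵀ *ᵥ (b k : n → ℝ), (‖WithLp.toLp 2 u‖⁻¹ * r) ^ 2, i₀, sq_nonneg _, ?_⟩
  have h0 : (‖WithLp.toLp 2 u‖⁻¹ * r) ^ 2 • vecMulVec s s =
      vecMulVec (Rᵀ *ᵥ (b i₀ : n → ℝ)) (Rᵀ *ᵥ (b i₀ : n → ℝ)) := by
    have : (b i₀ : n → ℝ) = ‖WithLp.toLp 2 u‖⁻¹ • u := by rw [hb0, he]; rfl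
    rw [this, mulVec_smul, hu, smul_smul]
    ext i j
    simp [vecMulVec_apply]; ring
  rw [h0, Finset.add_sum_erase _ (fun k => vecMulVec (Rᵀ *ᵥ (b k : n → ℝ)) (Rᵀ *ᵥ (b k : n → ℝ)))
    (Finset.mem_univ _), hR]
  have : ∀ k, vecMulVec (Rᵀ *ᵥ (b k : n → ℝ)) (Rᵀ *ᵥ (b k : n → ℝ)) =
      Rᵀ * vecMulVec (b k : n → ℝ) (b k) * R := fun k => by
    rw [mul_vecMulVec, vecMulVec_mul, ← mulVec_transpose]
  simp only [this, ← Finset.sum_mul, ← Finset.mul_sum, hsum]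
  simp

/-- Positivity of the noncentral Wishart transform with arbitrary noncentrality for every real
number of degrees of freedom greater than `n - 1`. -/
theorem kernelPositive_wishartTransform_of_card {α : ℝ} (hα : (Fintype.card n : ℝ) - 1 < 2 * α)
    {S : Matrix n n ℝ} (hS : S.PosSemidef) {Δ : Matrix n n ℝ} (hΔ : Δ.PosSemidef) :
    KernelPositive expTrace {T | T.PosSemidef} {X | X.PosSemidef} (wishartTransform α S Δ) := by
  refine kernelPositive_wishartTransform ?_ hS hΔ
  intro s Δ hΔ
  by_cases hs : s = 0
  · subst hs
    exact (KernelPositive.of_mem hΔ).congr fun T _ => by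
      rw [zero_vecMulVec, wishartTransform_zero_scale]
  obtain ⟨m, δ, i₀, hδ, hdec⟩ := exists_rankOne_decomposition hΔ hs
  have hcard : ((Finset.univ.erase i₀).card : ℝ) = Fintype.card n - 1 := by
    rw [Finset.card_erase_of_mem (Finset.mem_univ _), Finset.card_univ, Nat.cast_sub, Nat.cast_one]
    exact Fintype.card_pos_iff.2 ⟨i₀⟩
  have hβ : 0 < α - (Finset.univ.erase i₀).card * (1 / 2) := by rw [hcard]; linarith
  have h1 : ∃ X ∈ {X : Matrix n n ℝ | X.PosSemidef}, ∀ T ∈ {T : Matrix n n ℝ | T.PosSemidef},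
      expTrace T X = 1 := ⟨0, PosSemidef.zero, fun T _ => expTrace_zero T⟩
  have hE : ∀ X ∈ {X : Matrix n n ℝ | X.PosSemidef}, ∀ Y ∈ {X : Matrix n n ℝ | X.PosSemidef},
      ∃ Z ∈ {X : Matrix n n ℝ | X.PosSemidef}, ∀ T ∈ {T : Matrix n n ℝ | T.PosSemidef},
      expTrace T X * expTrace T Y = expTrace T Z :=
    fun X hX Y hY => ⟨X + Y, hX.add hY, fun T _ => (expTrace_add T X Y).symm⟩
  refine ((kernelPositive_noncentralGamma s hβ hδ).mul hE (KernelPositive.prod h1 hE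
    (Finset.univ.erase i₀) fun k _ => (kernelPositive_gaussian s (m k)).mono
      rankOneCone_subset)).congr fun T hT => ?_
  have hq : 0 < 1 + s ⬝ᵥ T *ᵥ s := by
    have := quadForm_nonneg hT s
    linarith
  have hδs : δ • vecMulVec s s = vecMulVec (√δ • s) (√δ • s) := by
    ext i j
    simp only [vecMulVec_apply, Matrix.smul_apply, Pi.smul_apply, smul_eq_mul]
    linear_combination -(s i * s j) * Real.mul_self_sqrt hδ
  rw [wishartTransform, det_one_add_vecMulVec_mul, hdec, expTrace_add, expTrace_sum, hδs,
    expTrace_rankOne s _ hT]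
  simp only [expTrace_rankOne s _ hT, Finset.prod_mul_distrib, Finset.prod_const]
  rw [← Real.rpow_natCast ((1 + s ⬝ᵥ T *ᵥ s) ^ (-(1 / 2) : ℝ)), ← Real.rpow_mul hq.le]
  have e1 : (1 + s ⬝ᵥ T *ᵥ s) ^ (-α) =
      (1 + s ⬝ᵥ T *ᵥ s) ^ (-(α - (Finset.univ.erase i₀).card * (1 / 2))) *
        (1 + s ⬝ᵥ T *ᵥ s) ^ (-(1 / 2) * ((Finset.univ.erase i₀).card : ℝ)) := by
    rw [← Real.rpow_add hq]; congr 1; ring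
  have e2 : -((√δ • s) ⬝ᵥ T *ᵥ (√δ • s)) + (s ⬝ᵥ T *ᵥ (√δ • s)) ^ 2 / (1 + s ⬝ᵥ T *ᵥ s) =
      δ * (-(s ⬝ᵥ T *ᵥ s) + (s ⬝ᵥ T *ᵥ s) ^ 2 / (1 + s ⬝ᵥ T *ᵥ s)) := by
    simp only [mulVec_smul, dotProduct_smul, smul_dotProduct, smul_eq_mul, mul_pow,
      Real.sq_sqrt hδ, ← mul_assoc, Real.mul_self_sqrt hδ]
    ring
  rw [e1, e2]
  ring

end Wishart

section Representation

open scoped CompactlySupported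

/-- A functional on the span of a family of continuous functions on a compact space which contains
the constants is represented by a measure as soon as it is nonnegative on nonnegative
combinations. -/
theorem exists_measure_integral_eq {τ : Type} {Y : Type*} [TopologicalSpace Y] [CompactSpace Y]
    [T2Space Y] [MeasurableSpace Y] [BorelSpace Y] (f : τ → C(Y, ℝ)) (F : τ → ℝ)
    (h1 : ∃ t₀, f t₀ = 1) (hF : KernelPositive (fun t y => f t y) Set.univ Set.univ F) :
    ∃ μ : Measure Y, IsFiniteMeasure μ ∧ ∀ t, ∫ y, f t y ∂μ = F t := by
  let φ : τ → C_c(Y, ℝ) := fun t => CompactlySupportedContinuousMap.continuousMapEquiv (f t)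
  have hφ : ∀ t y, φ t y = f t y := fun t y => rfl
  let L : (τ →₀ ℝ) →ₗ[ℝ] C_c(Y, ℝ) := Finsupp.linearCombination ℝ φ
  let G : (τ →₀ ℝ) →ₗ[ℝ] ℝ := Finsupp.linearCombination ℝ F
  have hL : ∀ a y, L a y = ∑ t ∈ a.support, a t * f t y := by
    intro a y
    simp only [L, Finsupp.linearCombination_apply, Finsupp.sum,
      CompactlySupportedContinuousMap.sum_apply, CompactlySupportedContinuousMap.smul_apply, hφ,
      smul_eq_mul]
  have hG : ∀ a, G a = ∑ t ∈ a.support, a t * F t := by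
    intro a
    simp only [G, Finsupp.linearCombination_apply, Finsupp.sum, smul_eq_mul]
  have hpos : ∀ a, 0 ≤ L a → 0 ≤ G a := by
    intro a ha
    rw [hG]
    refine hF τ a.support a id (fun _ => trivial) fun y _ => ?_
    have := ha y
    rwa [hL] at this
  have hker : LinearMap.ker L ≤ LinearMap.ker G := by
    intro a ha
    have ha' : L a = 0 := ha
    have h2 := hpos (-a) (by rw [map_neg, ha', neg_zero])
    rw [map_neg] at h2
    exact le_antisymm (by linarith) (hpos a ha'.ge)
  let g : C_c(Y, ℝ) →ₗ.[ℝ] ℝ :=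
    ⟨LinearMap.range L, (LinearMap.ker L).liftQ G hker ∘ₗ L.quotKerEquivRange.symm.toLinearMap⟩
  have hg : ∀ a (h : L a ∈ g.domain), g ⟨L a, h⟩ = G a := by
    intro a h
    change (LinearMap.ker L).liftQ G hker (L.quotKerEquivRange.symm ⟨L a, h⟩) = G a
    have : L.quotKerEquivRange.symm ⟨L a, h⟩ = (LinearMap.ker L).mkQ a := by
      rw [LinearEquiv.symm_apply_eq]
      rfl
    rw [this]
    simp
  let s : PointedCone ℝ C_c(Y, ℝ) :=
    { carrier := {f | 0 ≤ f}
      add_mem' := fun {a b} ha hb y => add_nonneg (ha y) (hb y)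
      zero_mem' := fun _ => le_rfl
      smul_mem' := fun c x hx y => mul_nonneg c.2 (hx y) }
  obtain ⟨t₀, ht₀⟩ := h1
  obtain ⟨Λ, hΛ, hΛs⟩ := riesz_extension s g (by
      rintro ⟨_, a, rfl⟩ ha
      exact (hpos a ha).trans_eq (hg a ⟨a, rfl⟩).symm) (by
      intro x
      obtain ⟨C, hC⟩ := (isCompact_range x.continuous).bddBelow
      refine ⟨⟨L (Finsupp.single t₀ (-C)), ⟨_, rfl⟩⟩, fun y => ?_⟩
      have : C ≤ x y := hC ⟨y, rfl⟩
      have e : L (Finsupp.single t₀ (-C)) y = -C := by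
        simp [L, Finsupp.linearCombination_single, hφ, ht₀]
      change 0 ≤ L (Finsupp.single t₀ (-C)) y + x y
      rw [e]; linarith)
  let Λ' : C_c(Y, ℝ) →ₚ[ℝ] ℝ := PositiveLinearMap.mk₀ Λ hΛs
  have hint : ∀ t, ∫ y, f t y ∂(RealRMK.rieszMeasure Λ') = F t := by
    intro t
    have h := RealRMK.integral_rieszMeasure Λ' (φ t)
    have e : L (Finsupp.single t 1) = φ t := by simp [L]
    have h' : Λ (φ t) = F t := by
      have := (hΛ ⟨L (Finsupp.single t 1), ⟨_, rfl⟩⟩).trans (hg _ ⟨_, rfl⟩)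
      simpa [e, G] using this
    exact h.trans h'
  exact ⟨RealRMK.rieszMeasure Λ', inferInstance, hint⟩

variable {p : Type} [Fintype p]

/-- The Laplace kernel `exp (-∑ tⱼ xⱼ)`. -/
noncomputable def expDot (t x : p → ℝ) : ℝ := Real.exp (-∑ j, t j * x j)

/-- Products of powers as continuous functions on the unit cube. -/
noncomputable def cubeMonomial (t : {t : p → ℝ // 0 ≤ t}) : C(p → unitInterval, ℝ) where
  toFun y := ∏ j, (y j : ℝ) ^ t.1 j
  continuous_toFun := continuous_finsetProd _ fun j _ =>
    (continuous_subtype_val.comp (continuous_apply j)).rpow_const fun _ => Or.inr (t.2 j)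

/-- A Hausdorff–Bernstein–Widder type theorem on the orthant. -/
theorem exists_probabilityMeasure_of_kernelPositive [DecidableEq p] {F : (p → ℝ) → ℝ}
    (hF : KernelPositive expDot {t | 0 ≤ t} {x | 0 ≤ x} F) (hF0 : F 0 = 1)
    (hcont : ContinuousAt F 0) :
    ∃ μ : Measure (p → ℝ), IsProbabilityMeasure μ ∧ μ {x | ∀ i, 0 ≤ x i}ᶜ = 0 ∧
      ∀ t : p → ℝ, (∀ j, 0 ≤ t j) → ∫ x, Real.exp (-∑ j, t j * x j) ∂μ = F t := by
  obtain ⟨m, hm, hmF⟩ := exists_measure_integral_eq (cubeMonomial (p := p)) (fun t => F t.1)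
    ⟨⟨0, le_rfl⟩, by ext y; simp [cubeMonomial]⟩ (by
      intro ι s c t _ hc
      refine hF ι s c (fun i => (t i).1) (fun i => (t i).2) fun x hx => ?_
      convert! hc (fun j => ⟨Real.exp (-x j), (Real.exp_pos _).le,
        Real.exp_le_one_iff.2 (neg_nonpos.2 (hx j))⟩) trivial using 4 with i
      simp only [expDot, cubeMonomial, ContinuousMap.coe_mk, ← Real.exp_mul, ← Real.exp_sum]
      congr 1
      rw [← Finset.sum_neg_distrib]
      exact Finset.sum_congr rfl fun j _ => by ring)
  have hm1 : IsProbabilityMeasure m := by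
    have h := hmF ⟨0, le_rfl⟩
    simp only [cubeMonomial, ContinuousMap.coe_mk, Pi.zero_apply, Real.rpow_zero,
      Finset.prod_const_one, integral_const, smul_eq_mul, mul_one, hF0] at h
    refine ⟨?_⟩
    rw [measureReal_def, ENNReal.toReal_eq_one_iff] at h
    exact h
  have hne : ∀ j, ∀ᵐ y ∂m, (y j : ℝ) ≠ 0 := by
    intro j
    have hmeas : MeasurableSet {y : p → unitInterval | (y j : ℝ) ≠ 0} :=
      (measurableSet_eq_fun (by fun_prop) measurable_const).compl
    let ε : ℕ → {t : p → ℝ // 0 ≤ t} := fun k =>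
      ⟨Pi.single j (1 / ((k : ℝ) + 1)), Pi.single_nonneg.2 (by positivity)⟩
    have hε : ∀ k (y : p → unitInterval),
        cubeMonomial (ε k) y = (y j : ℝ) ^ (1 / ((k : ℝ) + 1)) := by
      intro k y
      simp only [cubeMonomial, ContinuousMap.coe_mk, ε]
      rw [Finset.prod_eq_single j]
      · simp
      · intro i _ hij
        simp [Pi.single_eq_of_ne hij]
      · simp
    have hlim0 := tendsto_one_div_add_atTop_nhds_zero_nat (𝕜 := ℝ)
    have hA : Filter.Tendsto (fun k => ∫ y, cubeMonomial (ε k) y ∂m) Filter.atTop (nhds 1) := by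
      simp only [hmF]
      rw [← hF0]
      refine hcont.tendsto.comp ?_
      have : Filter.Tendsto (fun k : ℕ => (Pi.single j (1 / ((k : ℝ) + 1)) : p → ℝ))
          Filter.atTop (nhds (Pi.single j 0)) :=
        ((continuous_single (A := fun _ : p => ℝ) j).tendsto 0).comp hlim0
      rwa [Pi.single_zero] at this
    have hB : Filter.Tendsto (fun k => ∫ y, cubeMonomial (ε k) y ∂m) Filter.atTop
        (nhds (∫ y, {y : p → unitInterval | (y j : ℝ) ≠ 0}.indicator
          (1 : (p → unitInterval) → ℝ) y ∂m)) := by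
      refine tendsto_integral_of_dominated_convergence (fun _ => (1 : ℝ))
        (fun k => (cubeMonomial (ε k)).continuous.aestronglyMeasurable) (integrable_const _)
        (fun k => .of_forall fun y => ?_) (.of_forall fun y => ?_)
      · rw [hε, Real.norm_of_nonneg (Real.rpow_nonneg (y j).2.1 _)]
        exact Real.rpow_le_one (y j).2.1 (y j).2.2 (by positivity)
      · simp only [hε]
        by_cases hy : (y j : ℝ) = 0
        · have : ∀ k : ℕ, (0 : ℝ) ^ (1 / ((k : ℝ) + 1)) = 0 := fun k =>
            Real.zero_rpow (by positivity)
          rw [Set.indicator_of_notMem (by simpa using hy)]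
          simp only [hy, this, tendsto_const_nhds]
        · have h := (Real.continuousAt_const_rpow (b := (0 : ℝ)) hy).tendsto.comp hlim0
          rw [Set.indicator_of_mem (by simpa using hy)]
          simpa only [Function.comp_def, Real.rpow_zero] using! h
    have h := tendsto_nhds_unique hB hA
    rw [integral_indicator_one hmeas, measureReal_def, ENNReal.toReal_eq_one_iff] at h
    exact (prob_compl_eq_zero_iff hmeas).2 h
  have hmeas : Measurable fun (y : p → unitInterval) j => -Real.log (y j) := by fun_prop
  refine ⟨m.map fun y j => -Real.log (y j), Measure.isProbabilityMeasure_map hmeas.aemeasurable,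
    ?_, fun t ht => ?_⟩
  · rw [Measure.map_apply hmeas]
    · convert! measure_empty (μ := m)
      ext y
      simp only [Set.mem_preimage, Set.mem_compl_iff, Set.mem_ofPred_eq, Set.mem_empty_iff_false,
        iff_false, not_not, neg_nonneg]
      exact fun i => Real.log_nonpos (y i).2.1 (y i).2.2
    · refine MeasurableSet.compl ?_
      simp only [Set.ofPred_forall]
      exact MeasurableSet.iInter fun i => measurableSet_le measurable_const (measurable_pi_apply i)
  · rw [integral_map hmeas.aemeasurable (Continuous.aestronglyMeasurable (by fun_prop)),
      ← hmF ⟨t, ht⟩]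
    refine integral_congr_ae ?_
    filter_upwards [ae_all_iff.2 hne] with y hy
    simp only [cubeMonomial, ContinuousMap.coe_mk]
    rw [← Finset.sum_neg_distrib, Real.exp_sum]
    refine Finset.prod_congr rfl fun j _ => ?_
    rw [Real.rpow_def_of_pos (lt_of_le_of_ne (y j).2.1 (Ne.symm (hy j)))]
    congr 1; ring

end Representation

section MultivariateGamma

theorem one_expDot {p : Type} [Fintype p] :
    ∃ x ∈ {x : p → ℝ | 0 ≤ x}, ∀ t ∈ {t : p → ℝ | 0 ≤ t}, expDot t x = 1 :=
  ⟨0, show (0 : p → ℝ) ≤ 0 from le_rfl, fun t _ => by simp [expDot]⟩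

theorem expDot_mul {p : Type} [Fintype p] : ∀ x ∈ {x : p → ℝ | 0 ≤ x}, ∀ y ∈ {x : p → ℝ | 0 ≤ x},
    ∃ z ∈ {x : p → ℝ | 0 ≤ x}, ∀ t ∈ {t : p → ℝ | 0 ≤ t}, expDot t x * expDot t y = expDot t z :=
  fun x hx y hy => ⟨x + y, show 0 ≤ x + y from add_nonneg hx hy, fun t _ => by
    simp only [expDot, ← Real.exp_add, Pi.add_apply, mul_add, Finset.sum_add_distrib]
    congr 1; ring⟩

theorem expTrace_diagonal {p : Type} [Fintype p] [DecidableEq p] (t : p → ℝ) (X : Matrix p p ℝ) :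
    expTrace (diagonal t) X = expDot t X.diag := by
  simp [expTrace, expDot, trace, diagonal_mul]

theorem kernelPositive_det_of_nat {p : Type} [Fintype p] [DecidableEq p] {S : Matrix p p ℝ}
    (hS : S.PosSemidef) {α : ℝ} {k : ℕ} (hα : 2 * α = k) :
    KernelPositive expDot {t | 0 ≤ t} {x | 0 ≤ x} fun t => (1 + S * diagonal t).det ^ (-α) := by
  have h0 : (0 : Matrix p p ℝ) ∈ rankOneCone p := ⟨0, by simp⟩
  have h := (kernelPositive_wishartTransform_half hS h0).comp (E := expDot) (P := {t | 0 ≤ t})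
    (D := {x | 0 ≤ x}) (g := fun _ => 1) (φ := diagonal)
    (fun t ht => PosSemidef.diagonal ht) fun X hX =>
      (KernelPositive.of_mem (D := {x | 0 ≤ x}) (x := X.diag)
        (show 0 ≤ X.diag from fun i => (rankOneCone_subset hX).diag_nonneg)).congr
        fun t _ => by rw [one_mul, expTrace_diagonal]
  refine (KernelPositive.prod one_expDot expDot_mul (Finset.range k) fun _ _ => h).congr
    fun t ht => ?_
  have hd := one_add_mul_det_pos hS (PosSemidef.diagonal ht)
  rw [Finset.prod_const, Finset.card_range, one_mul, wishartTransform_zero, ← Real.rpow_natCast,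
    ← Real.rpow_mul hd.le, ← hα]
  congr 1; ring

/-- The determinant of the `Γ_p` Laplace transform factors through a Schur complement. -/
theorem det_one_add_fromBlocks_mul {m n : Type*} [Fintype m] [DecidableEq m] [Fintype n]
    [DecidableEq n] {A T : Matrix m m ℝ} {B : Matrix m n ℝ} {D U : Matrix n n ℝ}
    (hA : A.PosDef) (hd : (1 + (D - Bᴴ * A⁻¹ * B) * U).det ≠ 0) :
    (1 + fromBlocks A B Bᴴ D * fromBlocks T 0 0 U).det =
      (1 + (D - Bᴴ * A⁻¹ * B) * U).det *
        (1 + A * (T + (A⁻¹ * B) * (U * (1 + (D - Bᴴ * A⁻¹ * B) * U)⁻¹) * (A⁻¹ * B)ᴴ)).det := by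
  have hAu : IsUnit A.det := hA.det_pos.ne'.isUnit
  set V := 1 + (D - Bᴴ * A⁻¹ * B) * U with hV
  have : Invertible V := invertibleOfIsUnitDet V hd.isUnit
  have e : fromBlocks 1 0 (-(Bᴴ * A⁻¹)) 1 * (1 + fromBlocks A B Bᴴ D * fromBlocks T 0 0 U) =
      fromBlocks (1 + A * T) (B * U) (-(Bᴴ * A⁻¹)) V := by
    rw [← fromBlocks_one, fromBlocks_multiply, fromBlocks_add, fromBlocks_multiply]
    congr 1
    · simp
    · simp
    · simp only [Matrix.mul_add, Matrix.neg_mul, Matrix.mul_zero, add_zero, Matrix.one_mul,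
        Matrix.mul_one, Matrix.mul_assoc, nonsing_inv_mul_cancel_left _ _ hAu]
      abel
    · simp only [hV, Matrix.neg_mul, Matrix.mul_zero, zero_add, Matrix.one_mul,
        Matrix.mul_assoc, Matrix.sub_mul]
      abel
  have hdet := congrArg det e
  rw [det_mul, det_fromBlocks_zero₁₂, det_one, det_one, one_mul, one_mul, det_fromBlocks₂₂,
    invOf_eq_nonsing_inv] at hdet
  rw [hdet]
  congr 2
  have hAh : (A⁻¹)ᴴ = A⁻¹ := hA.inv.isHermitian.eq
  rw [conjTranspose_mul, hAh]
  simp only [Matrix.mul_add, Matrix.mul_neg, sub_neg_eq_add, Matrix.mul_assoc,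
    mul_nonsing_inv_cancel_left _ _ hAu, add_assoc]

theorem kernelPositive_det_fromBlocks {m n : Type} [Fintype m] [DecidableEq m] [Fintype n]
    [DecidableEq n] {S : Matrix (m ⊕ n) (m ⊕ n) ℝ} (hS : S.PosDef) {α : ℝ}
    (hm : (Fintype.card m : ℝ) - 1 < 2 * α) (hn : (Fintype.card n : ℝ) - 1 < 2 * α) :
    KernelPositive expDot {t | 0 ≤ t} {x | 0 ≤ x} fun t => (1 + S * diagonal t).det ^ (-α) := by
  obtain ⟨A, B, D, rfl⟩ : ∃ A B D, S = fromBlocks A B Bᴴ D := by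
    refine ⟨S.toBlocks₁₁, S.toBlocks₁₂, S.toBlocks₂₂, ?_⟩
    have : S.toBlocks₁₂ᴴ = S.toBlocks₂₁ := by
      ext i j
      exact hS.isHermitian.apply (Sum.inr i) (Sum.inl j)
    rw [this, fromBlocks_toBlocks]
  have hA : A.PosDef := by
    exact hS.submatrix (e := Sum.inl) Sum.inl_injective
  have : Invertible A := hA.isUnit.invertible
  set R := D - Bᴴ * A⁻¹ * B with hR
  have hRp : R.PosSemidef := (PosDef.fromBlocks₁₁ B D hA).1 hS.posSemidef
  set C := A⁻¹ * B with hC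
  let T₁ : (m ⊕ n → ℝ) → Matrix m m ℝ := fun t => diagonal (t ∘ Sum.inl)
  let T₂ : (m ⊕ n → ℝ) → Matrix n n ℝ := fun t => diagonal (t ∘ Sum.inr)
  have hT₁ : ∀ t, 0 ≤ t → (T₁ t).PosSemidef := fun t ht => PosSemidef.diagonal fun i => ht _
  have hT₂ : ∀ t, 0 ≤ t → (T₂ t).PosSemidef := fun t ht => PosSemidef.diagonal fun i => ht _
  let φ : (m ⊕ n → ℝ) → Matrix m m ℝ := fun t =>
    T₁ t + C * (T₂ t * (1 + R * T₂ t)⁻¹) * Cᴴ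
  have hφ : ∀ t, 0 ≤ t → (φ t).PosSemidef := fun t ht =>
    (hT₁ t ht).add ((posSemidef_mul_inv_one_add_mul hRp (hT₂ t ht)).mul_mul_conjTranspose_same C)
  have h2 : ∀ X : Matrix m m ℝ, X.PosSemidef → KernelPositive expDot {t | 0 ≤ t} {x | 0 ≤ x}
      fun t => expTrace (T₁ t) X * wishartTransform α R (Cᴴ * X * C) (T₂ t) := by
    intro X hX
    refine (kernelPositive_wishartTransform_of_card hn hRp
      (hX.conjTranspose_mul_mul_same C)).comp (g := fun t => expTrace (T₁ t) X) (φ := T₂) hT₂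
      fun Y hY => ?_
    refine (KernelPositive.of_mem (x := Sum.elim X.diag Y.diag) ?_).congr fun t _ => ?_
    · rintro (i | i)
      · exact hX.diag_nonneg
      · exact PosSemidef.diag_nonneg hY
    · simp only [T₁, T₂, expTrace_diagonal, expDot, ← Real.exp_add, Fintype.sum_sum_type,
        Sum.elim_inl, Sum.elim_inr, Function.comp_apply]
      congr 1; ring
  refine ((kernelPositive_wishartTransform_of_card hm hA.posSemidef PosSemidef.zero).comp
    (g := fun t => (1 + R * T₂ t).det ^ (-α)) (φ := φ) hφ fun X hX => ?_).congr fun t ht => ?_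
  · refine (h2 X hX).congr fun t ht => ?_
    have : (C * (T₂ t * (1 + R * T₂ t)⁻¹) * Cᴴ * X).trace =
        (T₂ t * (1 + R * T₂ t)⁻¹ * (Cᴴ * X * C)).trace := by
      rw [Matrix.mul_assoc C, Matrix.mul_assoc C, trace_mul_comm]
      simp only [Matrix.mul_assoc]
    simp only [wishartTransform, expTrace, φ, add_mul, trace_add, this, neg_add, Real.exp_add]
    ring
  · have hd := one_add_mul_det_pos hRp (hT₂ t ht)
    have hdiag : diagonal t = fromBlocks (T₁ t) 0 0 (T₂ t) := by
      rw [fromBlocks_diagonal]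
      congr 1
      ext (i | i) <;> rfl
    rw [wishartTransform_zero, ← Real.mul_rpow hd.le
      (one_add_mul_det_pos hA.posSemidef (hφ t ht)).le, hdiag, det_one_add_fromBlocks_mul hA hd.ne']

theorem kernelPositive_det_of_lt {p : ℕ} (hp : 1 ≤ p) {S : Matrix (Fin p) (Fin p) ℝ}
    (hS : S.PosDef) {α : ℝ} (hα : (((p - 1) / 2 : ℕ) : ℝ) < 2 * α) :
    KernelPositive expDot {t | 0 ≤ t} {x | 0 ≤ x} fun t => (1 + S * diagonal t).det ^ (-α) := by
  have h₁ : ((((p - 1) / 2 + 1 : ℕ) : ℝ)) - 1 < 2 * α := by push_cast; linarith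
  have h₂ : ((p - ((p - 1) / 2 + 1) : ℕ) : ℝ) - 1 < 2 * α := by
    have : p - ((p - 1) / 2 + 1) ≤ (p - 1) / 2 + 1 := by omega
    have : ((p - ((p - 1) / 2 + 1) : ℕ) : ℝ) ≤ ((p - 1) / 2 + 1 : ℕ) := by exact_mod_cast this
    linarith
  let e : Fin ((p - 1) / 2 + 1) ⊕ Fin (p - ((p - 1) / 2 + 1)) ≃ Fin p :=
    finSumFinEquiv.trans (finCongr (by omega))
  have hSe : (S.submatrix e e).PosDef := hS.submatrix e.injective
  refine ((kernelPositive_det_fromBlocks hSe (by simpa using h₁) (by simpa using h₂)).comp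
    (g := fun _ => 1) (φ := fun t => t ∘ e) (P := {t | 0 ≤ t})
    (fun t ht => show 0 ≤ t ∘ e from fun i => ht _) fun x hx => ?_).congr
    fun t _ => ?_
  · refine (KernelPositive.of_mem (D := {x | 0 ≤ x}) (x := x ∘ e.symm)
      (show 0 ≤ x ∘ e.symm from fun i => hx _)).congr fun t _ => ?_
    rw [one_mul, expDot, expDot, ← e.sum_comp]
    simp
  · have : 1 + S.submatrix e e * diagonal (t ∘ e) = (1 + S * diagonal t).submatrix e e := by
      ext i j
      simp [mul_diagonal, one_apply]
    rw [one_mul, this, det_submatrix_equiv_self]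

end MultivariateGamma

/-- Theorem 2: the `Γ_p(α, Σ)` distribution exists for every positive integer `2α`
and for every real `2α > ⌊(p-1)/2⌋`. -/
theorem gamma_p_exists (p : ℕ) (hp : 1 ≤ p) (S : Matrix (Fin p) (Fin p) ℝ)
    (hS : S.PosDef) (α : ℝ) (hα : 0 < α)
    (hcond : (∃ n : ℕ, 0 < n ∧ 2 * α = n) ∨ 2 * α > ((p - 1) / 2 : ℕ)) :
    ∃ μ : Measure (Fin p → ℝ), IsProbabilityMeasure μ ∧
      μ {x | ∀ i, 0 ≤ x i}ᶜ = 0 ∧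
      ∀ t : Fin p → ℝ, (∀ j, 0 ≤ t j) →
        ∫ x, Real.exp (-∑ j, t j * x j) ∂μ
          = (1 + S * Matrix.diagonal t).det ^ (-α) := by
  have h0 : (1 + S * diagonal (0 : Fin p → ℝ)).det = 1 := by simp
  refine exists_probabilityMeasure_of_kernelPositive
    (F := fun t => (1 + S * diagonal t).det ^ (-α)) ?_ ?_ ?_
  · rcases hcond with ⟨n, -, hn⟩ | h
    · exact kernelPositive_det_of_nat hS.posSemidef hn
    · exact kernelPositive_det_of_lt hp hS h
  · rw [h0, Real.one_rpow]
  · refine ContinuousAt.rpow_const (Continuous.continuousAt ?_) (Or.inl (by rw [h0]; simp))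
    exact (continuous_const.add
      (continuous_const.matrix_mul continuous_id.matrix_diagonal)).matrix_det
end

section
/- Let p ≥ 2 be an integer and let Σ be a real symmetric positive definite p × p matrix. For every real α > 0 with 2α > p − 2, there exists a probability measure μ on ℝ^p, supported on the nonnegative orthant [0,∞)^p, such that for every t ∈ ℝ^p with all coordinates t_j ≥ 0, ∫ exp(−∑_{j=1}^p t_j x_j) dμ(x) = det(I_p + Σ·diag(t_1,…,t_p))^{−α}. -/
open MeasureTheory Matrix

theorem integral_exp_gaussianReal_half {s : ℝ} (hs : 0 ≤ s) (b : ℝ) :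
    ∫ z, Real.exp (-(2 * b * z + s * z ^ 2)) ∂(ProbabilityTheory.gaussianReal 0 (1 / 2))
      = (1 + s) ^ (-(1 / 2) : ℝ) * Real.exp (b ^ 2 / (1 + s)) := by
  have h1 : (0 : ℝ) < 1 + s := by linarith
  rw [ProbabilityTheory.integral_gaussianReal_eq_integral_smul (by norm_num)]
  have h2 : ∀ z : ℝ, ProbabilityTheory.gaussianPDFReal 0 (1 / 2) z •
      Real.exp (-(2 * b * z + s * z ^ 2)) = ((√Real.pi)⁻¹ * Real.exp (b ^ 2 / (1 + s))) *
        Real.exp (-(1 + s) * (z + b / (1 + s)) ^ 2) := by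
    intro z
    rw [ProbabilityTheory.gaussianPDFReal, smul_eq_mul, mul_assoc (√_)⁻¹, mul_assoc (√_)⁻¹,
      ← Real.exp_add, ← Real.exp_add]
    congr 1
    · congr 2
      push_cast
      ring
    · congr 1
      push_cast
      field_simp
      ring
  simp_rw [h2]
  rw [integral_const_mul, integral_add_right_eq_self (fun z => Real.exp (-(1 + s) * z ^ 2)),
    integral_gaussian, Real.sqrt_div Real.pi_pos.le, Real.rpow_neg h1.le, ← Real.sqrt_eq_rpow]
  have := Real.sqrt_pos.2 Real.pi_pos
  field_simp

theorem lintegral_exp_gammaMeasure {a s : ℝ} (ha : 0 < a) (hs : 0 ≤ s) :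
    ∫⁻ x, ENNReal.ofReal (Real.exp (-(s * x))) ∂(ProbabilityTheory.gammaMeasure a 1)
      = ENNReal.ofReal ((1 + s) ^ (-a)) := by
  have h1 : (0 : ℝ) < 1 + s := by linarith
  have hm : Measurable (ProbabilityTheory.gammaPDF a 1) :=
    (ProbabilityTheory.measurable_gammaPDFReal a 1).ennreal_ofReal
  rw [ProbabilityTheory.gammaMeasure, lintegral_withDensity_eq_lintegral_mul _ hm (by fun_prop)]
  have h2 : ∀ x, (ProbabilityTheory.gammaPDF a 1 * fun x => ENNReal.ofReal (Real.exp (-(s * x)))) x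
      = ENNReal.ofReal ((1 + s) ^ (-a)) * ProbabilityTheory.gammaPDF a (1 + s) x := by
    intro x
    rw [Pi.mul_apply, ProbabilityTheory.gammaPDF, ProbabilityTheory.gammaPDF,
      ← ENNReal.ofReal_mul' (Real.exp_pos _).le, ← ENNReal.ofReal_mul (by positivity)]
    congr 1
    unfold ProbabilityTheory.gammaPDFReal
    split_ifs with hx
    · rw [Real.rpow_neg h1.le, Real.one_rpow, mul_assoc, ← Real.exp_add]
      have := (Real.rpow_pos_of_pos h1 a).ne'
      field_simp
      congr 2
      ring
    · simp
  simp_rw [h2]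
  rw [lintegral_const_mul' _ _ ENNReal.ofReal_ne_top,
    ProbabilityTheory.lintegral_gammaPDF_eq_one ha h1, mul_one]

theorem integral_exp_gammaMeasure {a s : ℝ} (ha : 0 < a) (hs : 0 ≤ s) :
    ∫ x, Real.exp (-(s * x)) ∂(ProbabilityTheory.gammaMeasure a 1) = (1 + s) ^ (-a) := by
  rw [integral_eq_lintegral_of_nonneg_ae (ae_of_all _ fun x => (Real.exp_pos _).le) (by fun_prop),
    lintegral_exp_gammaMeasure ha hs, ENNReal.toReal_ofReal (by positivity)]

theorem ae_nonneg_gammaMeasure (a r : ℝ) :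
    ∀ᵐ x ∂(ProbabilityTheory.gammaMeasure a r), 0 ≤ x := by
  have hm : Measurable (ProbabilityTheory.gammaPDF a r) :=
    (ProbabilityTheory.measurable_gammaPDFReal a r).ennreal_ofReal
  rw [ProbabilityTheory.gammaMeasure, ae_withDensity_iff hm]
  refine ae_of_all _ fun x hx => ?_
  by_contra! h
  exact hx (ProbabilityTheory.gammaPDF_of_neg h)

theorem trace_vecMulVec_mul_self_transpose {n : Type*} [Fintype n] (v : n → ℝ)
    (A : Matrix n n ℝ) :
    (vecMulVec v v * (A * Aᵀ)).trace = v ᵥ* A ⬝ᵥ v ᵥ* A := by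
  rw [vecMulVec_mul, trace_vecMulVec, dotProduct_comm, ← vecMul_vecMul, ← dotProduct_mulVec,
    mulVec_transpose]

theorem trace_border {n : Type*} [Fintype n] (S A : Matrix n n ℝ) (b z : n → ℝ) (s h : ℝ) :
    (fromBlocks S (replicateCol (Fin 1) b) (replicateRow (Fin 1) b) (of fun _ _ => s) *
      (fromBlocks A 0 (replicateRow (Fin 1) z) (of fun _ _ => h) *
        (fromBlocks A 0 (replicateRow (Fin 1) z) (of fun _ _ => h))ᵀ)).trace
      = (S * (A * Aᵀ)).trace + (∑ i, (2 * (b ᵥ* A) i * z i + s * z i ^ 2) + s * h ^ 2) := by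
  have tr (P : Matrix n n ℝ) (Q R) (T : Matrix (Fin 1) (Fin 1) ℝ) :
      (fromBlocks P Q R T).trace = P.trace + T.trace := by simp [trace]
  rw [fromBlocks_transpose, fromBlocks_multiply, fromBlocks_multiply, tr]
  have h1 : (replicateCol (Fin 1) b * (replicateRow (Fin 1) z * Aᵀ)).trace = b ᵥ* A ⬝ᵥ z := by
    rw [trace_mul_comm, ← replicateRow_vecMul, vecMul_transpose]
    simp only [trace, diag_apply, replicateRow_mul_replicateCol_apply, Finset.univ_unique,
      Finset.sum_singleton]
    rw [dotProduct_comm, dotProduct_mulVec]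
  have h2 : (replicateRow (Fin 1) b * (A * replicateCol (Fin 1) z)).trace = b ᵥ* A ⬝ᵥ z := by
    rw [← replicateCol_mulVec]
    simp only [trace, diag_apply, replicateRow_mul_replicateCol_apply, Finset.univ_unique,
      Finset.sum_singleton]
    rw [dotProduct_mulVec]
  have h3 : ((of fun _ _ => s : Matrix (Fin 1) (Fin 1) ℝ) *
      (replicateRow (Fin 1) z * replicateCol (Fin 1) z +
        (of fun _ _ => h) * (of fun _ _ => h))).trace = s * (z ⬝ᵥ z) + s * h ^ 2 := by
    simp [trace, mul_apply, dotProduct]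
    ring
  have h4 : (of fun _ _ => h : Matrix (Fin 1) (Fin 1) ℝ)ᵀ = of fun _ _ => h := rfl
  simp only [transpose_zero, transpose_replicateRow, Matrix.mul_zero, Matrix.zero_mul, add_zero,
    trace_add, h1, h2, h3, h4]
  simp only [dotProduct, Finset.sum_add_distrib, mul_assoc, ← Finset.mul_sum, ← pow_two]
  ring

theorem det_one_add_border {n : Type*} [Fintype n] [DecidableEq n] (S : Matrix n n ℝ)
    (b : n → ℝ) {s : ℝ} (hs : 0 ≤ s) :
    (1 + fromBlocks S (replicateCol (Fin 1) b) (replicateRow (Fin 1) b) (of fun _ _ => s)).det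
      = (1 + s) * (1 + (S - (1 + s)⁻¹ • vecMulVec b b)).det := by
  have h1 : (1 : ℝ) + s ≠ 0 := by positivity
  rw [← fromBlocks_one, fromBlocks_add]
  have hD : (1 + of fun _ _ => s : Matrix (Fin 1) (Fin 1) ℝ) = (1 + s) • 1 := by
    ext i j; simp [Subsingleton.elim i j]
  rw [hD]
  let _ : Invertible ((1 + s) • (1 : Matrix (Fin 1) (Fin 1) ℝ)) :=
    invertibleOfRightInverse _ ((1 + s)⁻¹ • 1) (by simp [smul_smul, h1])
  rw [det_fromBlocks₂₂]
  have : ⅟((1 + s) • (1 : Matrix (Fin 1) (Fin 1) ℝ)) = (1 + s)⁻¹ • 1 := rfl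
  rw [this]
  rw [det_smul, det_one, vecMulVec_eq (Fin 1), Matrix.mul_smul, Matrix.mul_one, Matrix.smul_mul,
    zero_add, zero_add, add_sub_assoc, Fintype.card_fin, pow_one, mul_one]
  rfl

theorem posSemidef_schur_border {n : Type*} [Fintype n] [DecidableEq n] {S : Matrix n n ℝ}
    {b : n → ℝ} {s : ℝ} (hs : 0 ≤ s) (h : (fromBlocks S (replicateCol (Fin 1) b)
      (replicateRow (Fin 1) b) (of fun _ _ => s)).PosSemidef) :
    (S - (1 + s)⁻¹ • vecMulVec b b).PosSemidef := by
  have h1 : (0 : ℝ) < 1 + s := by positivity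
  have hD : ((1 + s) • (1 : Matrix (Fin 1) (Fin 1) ℝ)).PosDef := PosDef.one.smul h1
  let _ : Invertible ((1 + s) • (1 : Matrix (Fin 1) (Fin 1) ℝ)) :=
    invertibleOfRightInverse _ ((1 + s)⁻¹ • 1) (by simp [smul_smul, h1.ne'])
  have key := (PosDef.fromBlocks₂₂ S (replicateCol (Fin 1) b) hD).1 (by
    have h2 : (fromBlocks (0 : Matrix n n ℝ) 0 0 (1 : Matrix (Fin 1) (Fin 1) ℝ)).PosSemidef := by
      have : fromBlocks (0 : Matrix n n ℝ) 0 0 (1 : Matrix (Fin 1) (Fin 1) ℝ)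
          = diagonal (Sum.elim 0 1) := by
        rw [← diagonal_one, ← diagonal_zero, fromBlocks_diagonal]; rfl
      rw [this]
      exact PosSemidef.diagonal (by rintro (i | i) <;> simp)
    have h4 := h.add h2
    rw [fromBlocks_add] at h4
    have h5 : (of fun _ _ => s : Matrix (Fin 1) (Fin 1) ℝ) + 1 = (1 + s) • 1 := by
      ext i j; simp [Subsingleton.elim i j, add_comm]
    rw [h5, add_zero, add_zero, add_zero] at h4
    exact h4)
  have h3 : ((1 + s) • (1 : Matrix (Fin 1) (Fin 1) ℝ))⁻¹ = (1 + s)⁻¹ • 1 :=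
    inv_eq_right_inv (by simp [smul_smul, h1.ne'])
  rw [h3] at key
  rw [Matrix.mul_smul, Matrix.mul_one, Matrix.smul_mul] at key
  rw [vecMulVec_eq (Fin 1)]
  exact key

/-- There is a random square matrix `A`, indexed by `n`, for which `A * Aᵀ` has the Laplace
transform `det (1 + S) ^ (-a)` of the Wishart distribution of shape `a`. -/
def HasWishartFactor (n : Type) [Fintype n] [DecidableEq n] (a : ℝ) : Prop :=
  ∃ (Ω : Type) (_ : MeasurableSpace Ω) (P : Measure Ω) (A : Ω → Matrix n n ℝ),
    IsProbabilityMeasure P ∧ (∀ i j, Measurable fun ω => A ω i j) ∧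
      ∀ S : Matrix n n ℝ, S.PosSemidef →
        ∫ ω, Real.exp (-(S * (A ω * (A ω)ᵀ)).trace) ∂P = (1 + S).det ^ (-a)

theorem measurable_trace_mul_self_transpose {n Ω : Type*} [Fintype n] [MeasurableSpace Ω]
    {A : Ω → Matrix n n ℝ} (hA : ∀ i j, Measurable fun ω => A ω i j) (S : Matrix n n ℝ) :
    Measurable fun ω => (S * (A ω * (A ω)ᵀ)).trace := by
  simp only [trace, diag_apply, mul_apply, transpose_apply]
  fun_prop

theorem trace_mul_self_transpose_nonneg {n : Type*} [Fintype n] {S : Matrix n n ℝ}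
    (hS : S.PosSemidef) (A : Matrix n n ℝ) : 0 ≤ (S * (A * Aᵀ)).trace := by
  rw [← Matrix.mul_assoc, trace_mul_comm, ← Matrix.mul_assoc]
  exact (hS.conjTranspose_mul_mul_same A).trace_nonneg

theorem integrable_exp_neg {Ω : Type*} [MeasurableSpace Ω] {P : Measure Ω} [IsFiniteMeasure P]
    {f : Ω → ℝ} (hf : Measurable f) (h0 : ∀ᵐ ω ∂P, 0 ≤ f ω) :
    Integrable (fun ω => Real.exp (-f ω)) P := by
  refine Integrable.of_bound (by fun_prop) 1 ?_
  filter_upwards [h0] with ω hω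
  simpa using hω

namespace HasWishartFactor

theorem reindex {n m : Type} [Fintype n] [DecidableEq n] [Fintype m] [DecidableEq m] {a : ℝ}
    (h : HasWishartFactor n a) (e : n ≃ m) : HasWishartFactor m a := by
  obtain ⟨Ω, _, P, A, hP, hA, hL⟩ := h
  refine ⟨Ω, _, P, fun ω => (A ω).submatrix e.symm e.symm, hP, fun i j => hA _ _, fun S hS => ?_⟩
  have hd : (1 + S).det = (1 + S.submatrix e e).det := by
    rw [← det_submatrix_equiv_self e (1 + S), submatrix_add, Pi.add_apply, Pi.add_apply,
      submatrix_one_equiv]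
  rw [hd, ← hL _ (hS.submatrix e)]
  refine integral_congr_ae (ae_of_all _ fun ω => ?_)
  have ht : S * ((A ω).submatrix e.symm e.symm * ((A ω).submatrix e.symm e.symm)ᵀ)
      = (S.submatrix e e * (A ω * (A ω)ᵀ)).submatrix e.symm e.symm := by
    have hS' : (S.submatrix e e).submatrix e.symm e.symm = S := by
      rw [submatrix_submatrix, Equiv.self_comp_symm, submatrix_id_id]
    conv_lhs => rw [← hS', transpose_submatrix, submatrix_mul_equiv, submatrix_mul_equiv]
  have ht' (M : Matrix n n ℝ) : (M.submatrix e.symm e.symm).trace = M.trace :=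
    Equiv.sum_comp e.symm fun i => M i i
  simp only [ht, ht']

theorem of_isEmpty (n : Type) [Fintype n] [DecidableEq n] [IsEmpty n] (a : ℝ) :
    HasWishartFactor n a := by
  refine ⟨Unit, inferInstance, Measure.dirac (), fun _ => 0, inferInstance,
    fun i => isEmptyElim i, fun S _ => ?_⟩
  simp

/-- The Bartlett step: border the factor by a Gaussian row and the square root of a gamma
variable. -/
theorem border {n : Type} [Fintype n] [DecidableEq n] {a : ℝ} (h : HasWishartFactor n a)
    (ha : (Fintype.card n : ℝ) < 2 * a) : HasWishartFactor (n ⊕ Fin 1) a := by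
  obtain ⟨Ω, _, P, A, hP, hA, hL⟩ := h
  have ha' : 0 < a - Fintype.card n / 2 := by linarith
  have := ProbabilityTheory.isProbabilityMeasure_gammaMeasure ha' one_pos
  set G := ProbabilityTheory.gammaMeasure (a - Fintype.card n / 2) 1 with hG
  set N := Measure.pi fun _ : n => ProbabilityTheory.gaussianReal 0 (1 / 2) with hN
  have hB (i j : n ⊕ Fin 1) : Measurable fun q : Ω × ((n → ℝ) × ℝ) =>
      fromBlocks (A q.1) 0 (replicateRow (Fin 1) q.2.1) (of fun _ _ => √q.2.2) i j := by
    rcases i with i | i <;> rcases j with j | j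
    · exact (hA i j).comp measurable_fst
    · exact measurable_const
    · exact (measurable_pi_apply j).comp (measurable_fst.comp measurable_snd)
    · exact (measurable_snd.comp measurable_snd).sqrt
  refine ⟨Ω × ((n → ℝ) × ℝ), inferInstance, P.prod (N.prod G), _, inferInstance, hB,
    fun S hS => ?_⟩
  obtain ⟨T, b, s, rfl⟩ : ∃ (T : Matrix n n ℝ) (b : n → ℝ) (s : ℝ), S = fromBlocks T
      (replicateCol (Fin 1) b) (replicateRow (Fin 1) b) (of fun _ _ => s) := by
    refine ⟨S.toBlocks₁₁, fun i => S (.inl i) (.inr 0), S (.inr 0) (.inr 0), ?_⟩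
    ext (i | i) (j | j)
    · rfl
    · simp [Subsingleton.elim j 0]
    · simpa [Subsingleton.elim i 0] using hS.isHermitian.apply (.inl j) (.inr 0)
    · simp [Subsingleton.elim i 0, Subsingleton.elim j 0]
  have hs : 0 ≤ s := by simpa using hS.diag_nonneg (i := .inr 0)
  have h1 : 0 < 1 + s := by linarith
  have hR := posSemidef_schur_border hs hS
  rw [det_one_add_border T b hs, Real.mul_rpow h1.le (PosSemidef.one.add hR).det_nonneg, ← hL _ hR,
    ← integral_const_mul, integral_prod _ (integrable_exp_neg
      (measurable_trace_mul_self_transpose hB _)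
      (ae_of_all _ fun q => trace_mul_self_transpose_nonneg hS _))]
  refine integral_congr_ae (ae_of_all _ fun ω => ?_)
  have hg : ∀ᵐ q ∂(N.prod G), 0 ≤ q.2 :=
    Measure.quasiMeasurePreserving_snd.ae (ae_nonneg_gammaMeasure _ _)
  calc ∫ q : (n → ℝ) × ℝ, _ ∂(N.prod G)
    _ = ∫ q : (n → ℝ) × ℝ, Real.exp (-(T * (A ω * (A ω)ᵀ)).trace) *
          ((∏ i, Real.exp (-(2 * (b ᵥ* A ω) i * q.1 i + s * q.1 i ^ 2))) *
            Real.exp (-(s * q.2))) ∂(N.prod G) := by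
        refine integral_congr_ae ?_
        filter_upwards [hg] with q hq
        rw [trace_border, Real.sq_sqrt hq, ← Real.exp_sum, ← Real.exp_add, ← Real.exp_add,
          Finset.sum_neg_distrib]
        congr 1
        ring
    _ = Real.exp (-(T * (A ω * (A ω)ᵀ)).trace) *
          (((1 + s) ^ (-(1 / 2) : ℝ)) ^ Fintype.card n *
            Real.exp ((∑ i, (b ᵥ* A ω) i ^ 2) / (1 + s)) *
              (1 + s) ^ (-(a - Fintype.card n / 2))) := by
        rw [integral_const_mul, integral_prod_mul (fun z : n → ℝ =>
            ∏ i, Real.exp (-(2 * (b ᵥ* A ω) i * z i + s * z i ^ 2)))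
            (fun y => Real.exp (-(s * y))), integral_exp_gammaMeasure ha' hs,
          integral_fintype_prod_eq_prod (fun i x =>
            Real.exp (-(2 * (b ᵥ* A ω) i * x + s * x ^ 2)))]
        simp_rw [integral_exp_gaussianReal_half hs]
        rw [Finset.prod_mul_distrib, Finset.prod_const, Finset.card_univ, ← Real.exp_sum,
          Finset.sum_div]
    _ = (1 + s) ^ (-a) *
          Real.exp (-((T - (1 + s)⁻¹ • vecMulVec b b) * (A ω * (A ω)ᵀ)).trace) := by
        rw [← Real.rpow_natCast, ← Real.rpow_mul h1.le, Matrix.sub_mul, trace_sub,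
          Matrix.smul_mul, trace_smul, trace_vecMulVec_mul_self_transpose]
        have e1 : (1 + s) ^ (-a) = (1 + s) ^ (-(1 / 2) * (Fintype.card n : ℝ)) *
            (1 + s) ^ (-(a - Fintype.card n / 2)) := by
          rw [← Real.rpow_add h1]
          congr 1
          ring
        have e2 : (∑ i, (b ᵥ* A ω) i ^ 2) / (1 + s) = (1 + s)⁻¹ • (b ᵥ* A ω ⬝ᵥ b ᵥ* A ω) := by
          simp only [dotProduct, ← pow_two, smul_eq_mul]
          ring
        rw [e1, e2, neg_sub (trace _), Real.exp_sub, Real.exp_neg]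
        ring

end HasWishartFactor

theorem hasWishartFactor_fin (m : ℕ) {a : ℝ} (ha : (m : ℝ) < 2 * a + 1) :
    HasWishartFactor (Fin m) a := by
  induction m with
  | zero => exact .of_isEmpty _ _
  | succ m ih =>
    push_cast at ha
    exact ((ih (by linarith)).border (by rw [Fintype.card_fin]; linarith)).reindex finSumFinEquiv

/-- The mixture of gamma distributions of shape `a + k`, with `k` a Poisson variable of random
mean `Λ`, realised jointly with `Λ`. -/
theorem exists_poissonGammaMixture {Ω : Type*} [MeasurableSpace Ω] (P : Measure Ω)
    [IsProbabilityMeasure P] {Λ : Ω → ℝ} (hΛ : Measurable Λ) (h0 : ∀ ω, 0 ≤ Λ ω) {a : ℝ}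
    (ha : 0 < a) :
    ∃ Q : Measure (Ω × ℝ), IsProbabilityMeasure Q ∧ (∀ᵐ q ∂Q, 0 ≤ q.2) ∧
      ∀ f : Ω → ℝ, Measurable f → (∀ ω, 0 ≤ f ω) → ∀ s : ℝ, 0 ≤ s →
        ∫ q, Real.exp (-(f q.1 + s * q.2)) ∂Q
          = (1 + s) ^ (-a) * ∫ ω, Real.exp (-(f ω + s / (1 + s) * Λ ω)) ∂P := by
  have hak (k : ℕ) : 0 < a + k := by positivity
  have hG (k : ℕ) := ProbabilityTheory.isProbabilityMeasure_gammaMeasure (hak k) one_pos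
  let w (k : ℕ) (ω : Ω) : ENNReal := ENNReal.ofReal (Real.exp (-Λ ω) * (Λ ω ^ k / k.factorial))
  have hw (k : ℕ) : Measurable (w k) := by fun_prop
  let Q : Measure (Ω × ℝ) := Measure.sum fun k : ℕ =>
    (P.withDensity (w k)).prod (ProbabilityTheory.gammaMeasure (a + k) 1)
  have hQ (f : Ω → ℝ) (hf : Measurable f) (s : ℝ) (hs : 0 ≤ s) :
      ∫⁻ q, ENNReal.ofReal (Real.exp (-(f q.1 + s * q.2))) ∂Q
        = ∫⁻ ω, ENNReal.ofReal ((1 + s) ^ (-a) * Real.exp (-(f ω + s / (1 + s) * Λ ω))) ∂P := by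
    have h1 : 0 < 1 + s := by linarith
    rw [lintegral_sum_measure]
    have hk (k : ℕ) : ∫⁻ q, ENNReal.ofReal (Real.exp (-(f q.1 + s * q.2)))
          ∂((P.withDensity (w k)).prod (ProbabilityTheory.gammaMeasure (a + k) 1))
        = ∫⁻ ω, w k ω * ENNReal.ofReal (Real.exp (-f ω)) *
            ENNReal.ofReal ((1 + s) ^ (-(a + k))) ∂P := by
      have hsplit (q : Ω × ℝ) : ENNReal.ofReal (Real.exp (-(f q.1 + s * q.2)))
          = ENNReal.ofReal (Real.exp (-f q.1)) * ENNReal.ofReal (Real.exp (-(s * q.2))) := by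
        rw [← ENNReal.ofReal_mul (Real.exp_pos _).le, ← Real.exp_add, neg_add]
      simp_rw [hsplit]
      rw [lintegral_prod_mul (f := fun ω => ENNReal.ofReal (Real.exp (-f ω)))
        (g := fun y => ENNReal.ofReal (Real.exp (-(s * y)))) (by fun_prop) (by fun_prop),
        lintegral_exp_gammaMeasure (hak k) hs,
        lintegral_withDensity_eq_lintegral_mul _ (hw k) (by fun_prop),
        ← lintegral_mul_const _ (by fun_prop)]
      rfl
    simp_rw [hk]
    rw [← lintegral_tsum fun k => by fun_prop]
    refine lintegral_congr fun ω => ?_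
    have hterm (k : ℕ) : w k ω * ENNReal.ofReal (Real.exp (-f ω)) *
        ENNReal.ofReal ((1 + s) ^ (-(a + k)))
        = ENNReal.ofReal ((1 + s) ^ (-a) * Real.exp (-(f ω + Λ ω)) *
            ((Λ ω / (1 + s)) ^ k / k.factorial)) := by
      have := h0 ω
      rw [← ENNReal.ofReal_mul (by positivity), ← ENNReal.ofReal_mul (by positivity)]
      congr 1
      rw [neg_add a, Real.rpow_add h1, Real.rpow_neg h1.le k, Real.rpow_natCast, neg_add (f ω),
        Real.exp_add, div_pow]
      ring
    simp_rw [hterm]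
    have hsum : HasSum (fun k : ℕ => (1 + s) ^ (-a) * Real.exp (-(f ω + Λ ω)) *
        ((Λ ω / (1 + s)) ^ k / k.factorial))
        ((1 + s) ^ (-a) * Real.exp (-(f ω + Λ ω)) * Real.exp (Λ ω / (1 + s))) := by
      rw [Real.exp_eq_exp_ℝ]
      exact (NormedSpace.expSeries_div_hasSum_exp (Λ ω / (1 + s))).mul_left _
    rw [← ENNReal.ofReal_tsum_of_nonneg (fun k => by have := h0 ω; positivity) hsum.summable,
      hsum.tsum_eq, mul_assoc, ← Real.exp_add]
    congr 3
    field_simp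
    ring
  have hQP : IsProbabilityMeasure Q := ⟨by
    simpa using hQ (fun _ => 0) measurable_const 0 le_rfl⟩
  refine ⟨Q, hQP, ?_, fun f hf hf0 s hs => ?_⟩
  · rw [Measure.ae_sum_iff]
    exact fun k => Measure.quasiMeasurePreserving_snd.ae (ae_nonneg_gammaMeasure _ _)
  · rw [← integral_const_mul, integral_eq_lintegral_of_nonneg_ae
      (ae_of_all _ fun q => (Real.exp_pos _).le) (by fun_prop), hQ f hf s hs,
      integral_eq_lintegral_of_nonneg_ae (ae_of_all _ fun ω => by positivity) (by fun_prop)]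

open scoped MatrixOrder in
theorem Matrix.PosDef.exists_eq_self_mul_transpose {n : Type*} [Fintype n] [DecidableEq n]
    {S : Matrix n n ℝ} (hS : S.PosDef) : ∃ L : Matrix n n ℝ, IsUnit L ∧ S = L * Lᵀ := by
  have h0 : 0 ≤ S := hS.posSemidef.nonneg
  have hL : (CFC.sqrt S)ᵀ = CFC.sqrt S := (CFC.sqrt_nonneg S).posSemidef.isHermitian
  refine ⟨CFC.sqrt S, ?_, by rw [hL, CFC.sqrt_mul_sqrt_self S]⟩
  have := hS.isUnit
  rw [← CFC.sqrt_mul_sqrt_self S] at this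
  exact isUnit_of_mul_isUnit_left this

/-- One step of the Cholesky factorisation. -/
theorem Matrix.PosDef.exists_eq_border_mul_transpose {n : Type*} [Fintype n] [DecidableEq n]
    {S : Matrix (n ⊕ Fin 1) (n ⊕ Fin 1) ℝ} (hS : S.PosDef) :
    ∃ (L : Matrix n n ℝ) (u : n → ℝ) (r : ℝ), 0 < r ∧
      S = fromBlocks L 0 (replicateRow (Fin 1) u) (of fun _ _ => √r) *
        (fromBlocks L 0 (replicateRow (Fin 1) u) (of fun _ _ => √r))ᵀ := by
  have h11 : S.toBlocks₁₁.PosDef := hS.submatrix Sum.inl_injective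
  obtain ⟨L, hLu, hL⟩ := h11.exists_eq_self_mul_transpose
  obtain ⟨u, hu⟩ : ∃ u, L *ᵥ u = fun i => S (.inl i) (.inr 0) :=
    (mulVec_surjective_iff_isUnit.2 hLu) _
  have hdet := hS.det_pos
  have hblock : S = fromBlocks (L * Lᵀ) (replicateCol (Fin 1) (L *ᵥ u))
      (replicateRow (Fin 1) (L *ᵥ u)) (of fun _ _ => S (.inr 0) (.inr 0)) := by
    ext (i | i) (j | j)
    · rw [← hL]; rfl
    · simp [hu, Subsingleton.elim j 0]
    · simpa [hu, Subsingleton.elim i 0] using (hS.isHermitian.apply (.inl j) (.inr 0))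
    · simp [Subsingleton.elim i 0, Subsingleton.elim j 0]
  have hfac : ∀ h : ℝ, fromBlocks L 0 (replicateRow (Fin 1) u) (of fun _ _ => h) *
      (fromBlocks L 0 (replicateRow (Fin 1) u) (of fun _ _ => h))ᵀ =
      fromBlocks (L * Lᵀ) (replicateCol (Fin 1) (L *ᵥ u)) (replicateRow (Fin 1) (L *ᵥ u))
        (of fun _ _ => u ⬝ᵥ u + h ^ 2) := by
    intro h
    rw [fromBlocks_transpose, fromBlocks_multiply]
    congr 1
    · simp
    · simp [replicateCol_mulVec]
    · simp [← vecMul_transpose, replicateRow_vecMul]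
    · ext i j
      simp [mul_apply, dotProduct, pow_two]
  set r := S (.inr 0) (.inr 0) - u ⬝ᵥ u with hr
  have hSr : S = fromBlocks L 0 (replicateRow (Fin 1) u) (1 : Matrix (Fin 1) (Fin 1) ℝ) *
      fromBlocks Lᵀ (replicateCol (Fin 1) u) 0 (of fun _ _ => r) := by
    rw [fromBlocks_multiply]
    refine hblock.trans ?_
    congr 1
    · simp
    · simp [replicateCol_mulVec]
    · simp [← vecMul_transpose, replicateRow_vecMul]
    · ext i j
      simp [mul_apply, dotProduct, hr]
  have hpos : 0 < r := by
    rw [hSr, det_mul, det_fromBlocks_zero₁₂, det_fromBlocks_zero₂₁, det_transpose] at hdet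
    simp only [det_one, mul_one, det_fin_one, of_apply, ← mul_assoc] at hdet
    exact pos_of_mul_pos_right hdet (mul_self_nonneg _)
  refine ⟨L, u, r, hpos, ?_⟩
  rw [hfac, Real.sq_sqrt hpos.le, hr, add_sub_cancel]
  exact hblock

theorem det_one_add_mul_diagonal_border {n : Type*} [Fintype n] [DecidableEq n]
    (L : Matrix n n ℝ) (u : n → ℝ) {r : ℝ} (hr : 0 ≤ r) (t : n → ℝ) {τ : ℝ} (hτ : 0 ≤ τ) :
    (1 + fromBlocks L 0 (replicateRow (Fin 1) u) (of fun _ _ => √r) *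
      (fromBlocks L 0 (replicateRow (Fin 1) u) (of fun _ _ => √r))ᵀ *
        diagonal (Sum.elim t fun _ => τ)).det
      = (1 + τ * r) *
        (1 + (Lᵀ * diagonal t * L + (τ / (1 + τ * r)) • vecMulVec u u)).det := by
  rw [Matrix.mul_assoc, det_one_add_mul_comm, ← fromBlocks_diagonal, fromBlocks_transpose,
    fromBlocks_multiply, fromBlocks_multiply]
  have h1 : 1 + τ * r ≠ 0 := by positivity
  have key := det_one_add_border (Lᵀ * diagonal t * L + τ • vecMulVec u u) ((τ * √r) • u)
    (mul_nonneg hτ hr)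
  have hsch : Lᵀ * diagonal t * L + τ • vecMulVec u u -
      (1 + τ * r)⁻¹ • vecMulVec ((τ * √r) • u) ((τ * √r) • u)
      = Lᵀ * diagonal t * L + (τ / (1 + τ * r)) • vecMulVec u u := by
    rw [add_sub_assoc]
    congr 1
    ext i j
    simp only [Matrix.sub_apply, Matrix.smul_apply, vecMulVec_apply, Pi.smul_apply, smul_eq_mul]
    have : √r * √r = r := Real.mul_self_sqrt hr
    field_simp
    rw [Real.sq_sqrt hr]
    ring
  rw [hsch] at key
  rw [← key]
  congr 3
  · simp only [Matrix.mul_zero, add_zero]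
    congr 1
    ext i j
    simp [mul_apply, vecMulVec_apply]
    ring
  · ext i j
    simp [mul_apply]
    ring
  · ext i j
    simp [mul_apply]
    exact Or.inl (mul_comm _ _)
  · ext i j
    simp [mul_apply]
    rw [mul_right_comm, Real.mul_self_sqrt hr, mul_comm]

/-- A Wishart factor of size one less than that of `S` suffices to construct the multivariate
gamma distribution associated with `S`: the last coordinate is, conditionally on the factor, a
Poisson mixture of gamma distributions. -/
theorem exists_measure_of_hasWishartFactor {n : Type} [Fintype n] [DecidableEq n]
    {S : Matrix (n ⊕ Fin 1) (n ⊕ Fin 1) ℝ} (hS : S.PosDef) {a : ℝ} (ha : 0 < a)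
    (h : HasWishartFactor n a) :
    ∃ μ : Measure (n ⊕ Fin 1 → ℝ), IsProbabilityMeasure μ ∧ (∀ᵐ x ∂μ, ∀ i, 0 ≤ x i) ∧
      ∀ t : n ⊕ Fin 1 → ℝ, (∀ j, 0 ≤ t j) →
        ∫ x, Real.exp (-∑ j, t j * x j) ∂μ = (1 + S * diagonal t).det ^ (-a) := by
  obtain ⟨L, u, r, hr, hSL⟩ := hS.exists_eq_border_mul_transpose
  obtain ⟨Ω, _, P, A, hP, hA, hL⟩ := h
  have hu : (r⁻¹ • vecMulVec u u).PosSemidef :=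
    (posSemidef_vecMulVec_self_star u).smul (inv_nonneg.2 hr.le)
  obtain ⟨Q, hQ, hQ0, hQL⟩ := exists_poissonGammaMixture P
    (measurable_trace_mul_self_transpose hA (r⁻¹ • vecMulVec u u))
    (fun ω => trace_mul_self_transpose_nonneg hu (A ω)) ha
  let X (q : Ω × ℝ) : n ⊕ Fin 1 → ℝ :=
    Sum.elim (fun i => ∑ k, (L * A q.1) i k ^ 2) fun _ => r * q.2
  have hX : Measurable X := by
    refine measurable_pi_iff.2 fun i => ?_
    rcases i with i | i
    · simp only [X, Sum.elim_inl, mul_apply]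
      have hA' (i j : n) : Measurable fun q : Ω × ℝ => A q.1 i j := (hA i j).comp measurable_fst
      fun_prop
    · exact measurable_snd.const_mul r
  refine ⟨Q.map X, Measure.isProbabilityMeasure_map hX.aemeasurable, ?_, fun t ht => ?_⟩
  · rw [ae_map_iff hX.aemeasurable (by measurability)]
    filter_upwards [hQ0] with q hq
    rintro (i | i)
    · exact Finset.sum_nonneg fun k _ => sq_nonneg _
    · exact mul_nonneg hr.le hq
  · obtain ⟨t, τ, rfl⟩ : ∃ (t' : n → ℝ) (τ : ℝ), t = Sum.elim t' fun _ => τ :=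
      ⟨t ∘ Sum.inl, t (.inr 0), by
        ext (i | i)
        · rfl
        · rw [Subsingleton.elim i 0]; rfl⟩
    have hτ : 0 ≤ τ := ht (.inr 0)
    have hs : 0 ≤ τ * r := mul_nonneg hτ hr.le
    have hT : (Lᵀ * diagonal t * L).PosSemidef :=
      (PosSemidef.diagonal fun i => ht (.inl i)).conjTranspose_mul_mul_same L
    have hTu : (Lᵀ * diagonal t * L + (τ / (1 + τ * r)) • vecMulVec u u).PosSemidef :=
      hT.add ((posSemidef_vecMulVec_self_star u).smul (by positivity))
    have htr (B : Matrix n n ℝ) : (Lᵀ * diagonal t * L * (B * Bᵀ)).trace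
        = ∑ i, t i * ∑ k, (L * B) i k ^ 2 := by
      rw [Matrix.mul_assoc, Matrix.mul_assoc, trace_mul_comm, Matrix.mul_assoc,
        ← Matrix.mul_assoc L, Matrix.mul_assoc (L * B), ← transpose_mul]
      simp only [trace, diag_apply, diagonal_mul, mul_apply (M := L * B), transpose_apply, pow_two]
    rw [integral_map hX.aemeasurable (Measurable.aestronglyMeasurable (by fun_prop)), hSL,
      det_one_add_mul_diagonal_border L u hr.le t hτ,
      Real.mul_rpow (by positivity) (PosSemidef.one.add hTu).det_nonneg, ← hL _ hTu]
    have key := hQL _ (measurable_trace_mul_self_transpose hA (Lᵀ * diagonal t * L))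
      (fun ω => trace_mul_self_transpose_nonneg hT (A ω)) _ hs
    refine Eq.trans (integral_congr_ae (ae_of_all _ fun q => ?_)) (key.trans ?_)
    · simp only [htr]
      simp only [X, Fintype.sum_sum_type, Sum.elim_inl, Sum.elim_inr, Finset.univ_unique,
        Finset.sum_singleton, mul_assoc]
    · congr 1
      refine integral_congr_ae (ae_of_all _ fun ω => ?_)
      simp only [Matrix.add_mul, trace_add, Matrix.smul_mul, trace_smul, smul_eq_mul]
      congr 3
      field_simp

/-- The `Γ_p(α, Σ)` distribution exists for all real `2α > p - 2`, `p ≥ 2`. -/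
theorem gamma_p_exists_of_two_alpha_gt_p_sub_two (p : ℕ) (hp : 2 ≤ p)
    (S : Matrix (Fin p) (Fin p) ℝ) (hS : S.PosDef) (α : ℝ) (hα : 0 < α)
    (hcond : 2 * α > (p : ℝ) - 2) :
    ∃ μ : Measure (Fin p → ℝ), IsProbabilityMeasure μ ∧
      μ {x | ∀ i, 0 ≤ x i}ᶜ = 0 ∧
      ∀ t : Fin p → ℝ, (∀ j, 0 ≤ t j) →
        ∫ x, Real.exp (-∑ j, t j * x j) ∂μ
          = (1 + S * Matrix.diagonal t).det ^ (-α) := by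
  obtain ⟨m, rfl⟩ : ∃ m, p = m + 1 := ⟨p - 1, by omega⟩
  push_cast at hcond
  let e : Fin m ⊕ Fin 1 ≃ Fin (m + 1) := finSumFinEquiv
  obtain ⟨μ, hμ, hμ0, hμL⟩ := exists_measure_of_hasWishartFactor (hS.submatrix e.injective) hα
    (hasWishartFactor_fin m (by linarith))
  have hf : Measurable fun (x : Fin m ⊕ Fin 1 → ℝ) j => x (e.symm j) := by fun_prop
  refine ⟨μ.map fun x j => x (e.symm j), Measure.isProbabilityMeasure_map hf.aemeasurable, ?_,
    fun t ht => ?_⟩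
  · refine (ae_map_iff hf.aemeasurable (by measurability)).2 ?_
    filter_upwards [hμ0] with x hx i using hx _
  · rw [integral_map hf.aemeasurable (Measurable.aestronglyMeasurable (by fun_prop)),
      ← det_submatrix_equiv_self e, submatrix_add, Pi.add_apply, Pi.add_apply,
      submatrix_one_equiv, ← submatrix_mul_equiv _ _ _ e, submatrix_diagonal_equiv, ← hμL (t ∘ e) fun j => ht (e j)]
    refine integral_congr_ae (ae_of_all _ fun x => ?_)
    simp only [← e.sum_comp, Equiv.symm_apply_apply, Function.comp_apply]
end

section
/- Let p = p₁ + p₂ with p₁, p₂ ≥ 1, and let Σ be a real p × p matrix partitioned into blocks Σ₁₁ (p₁ × p₁), Σ₁₂ (p₁ × p₂), Σ₂₁ (p₂ × p₁), Σ₂₂ (p₂ × p₂), with Σ₂₂ invertible. Set Σ₀ = Σ₁₁ − Σ₁₂ Σ₂₂⁻¹ Σ₂₁. Let T₁ and T₂ be diagonal matrices of sizes p₁ × p₁ and p₂ × p₂, and assume I₁ + Σ₀T₁ is invertible. Then det(I_p + Σ·T) = det(I₁ + Σ₀T₁) · det(Σ₂₂) · det(Σ₂₂⁻¹ Σ₂₁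 T₁ (I₁ + Σ₀T₁)⁻¹ Σ₁₂ Σ₂₂⁻¹ + Σ₂₂⁻¹ + T₂), where T = diag(T₁, T₂) is the block-diagonal matrix built from T₁ and T₂. -/
open Matrix

/-- The determinant of `1 + S * T`, for a block matrix `S` with invertible lower right block `D`
and a block diagonal matrix `T = diag(X, Y)`, in terms of the Schur complement of `D` in `S`. -/
theorem Matrix.det_one_add_fromBlocks_mul_fromBlocks_diagonal {m n R : Type*} [Fintype m]
    [Fintype n] [DecidableEq m] [DecidableEq n] [CommRing R]
    (A : Matrix m m R) (B : Matrix m n R) (C : Matrix n m R) (D : Matrix n n R)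
    (X : Matrix m m R) (Y : Matrix n n R) (hD : IsUnit D.det)
    (hX : IsUnit (1 + (A - B * D⁻¹ * C) * X).det) :
    (1 + fromBlocks A B C D * fromBlocks X 0 0 Y).det
      = (1 + (A - B * D⁻¹ * C) * X).det * D.det *
        (D⁻¹ * C * X * (1 + (A - B * D⁻¹ * C) * X)⁻¹ * B * D⁻¹ + D⁻¹ + Y).det := by
  have elim : fromBlocks 1 (-(B * D⁻¹)) 0 1 * (1 + fromBlocks A B C D * fromBlocks X 0 0 Y)
      = fromBlocks (1 + (A - B * D⁻¹ * C) * X) (-(B * D⁻¹)) (C * X) (1 + D * Y) := by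
    have cancel : B * D⁻¹ * (D * Y) = B * Y := by
      rw [← Matrix.mul_assoc, nonsing_inv_mul_cancel_right _ _ hD]
    rw [← fromBlocks_one, fromBlocks_multiply, fromBlocks_add, fromBlocks_multiply]
    congr 1
    · simp only [Matrix.mul_zero, add_zero, zero_add, Matrix.one_mul, Matrix.neg_mul,
        Matrix.sub_mul, Matrix.mul_assoc]
      abel
    · simp only [Matrix.mul_zero, zero_add, Matrix.one_mul, Matrix.neg_mul, Matrix.mul_add,
        Matrix.mul_one, cancel]
      abel
    · simp
    · simp
  generalize 1 + (A - B * D⁻¹ * C) * X = E at elim hX ⊢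
  have factor : 1 + D * Y - C * X * E⁻¹ * -(B * D⁻¹)
      = D * (D⁻¹ * C * X * E⁻¹ * B * D⁻¹ + D⁻¹ + Y) := by
    simp only [Matrix.mul_add, Matrix.mul_assoc, mul_nonsing_inv_cancel_left _ _ hD,
      mul_nonsing_inv _ hD, Matrix.mul_neg]
    abel
  have : Invertible E := invertibleOfIsUnitDet E hX
  have hdet := congrArg det elim
  rw [det_mul, det_fromBlocks_zero₂₁, det_one, det_one, one_mul, one_mul, det_fromBlocks₁₁,
    invOf_eq_nonsing_inv, factor, det_mul, ← mul_assoc] at hdet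
  exact hdet

/-- Final determinant identity in the proof of Theorem 1. -/
theorem det_identity_final_step (p₁ p₂ : ℕ) (hp₁ : 1 ≤ p₁) (hp₂ : 1 ≤ p₂)
    (S₁₁ : Matrix (Fin p₁) (Fin p₁) ℝ) (S₁₂ : Matrix (Fin p₁) (Fin p₂) ℝ)
    (S₂₁ : Matrix (Fin p₂) (Fin p₁) ℝ) (S₂₂ : Matrix (Fin p₂) (Fin p₂) ℝ)
    (hS₂₂ : IsUnit S₂₂.det)
    (t₁ : Fin p₁ → ℝ) (t₂ : Fin p₂ → ℝ)
    (S₀ : Matrix (Fin p₁) (Fin p₁) ℝ) (hS₀ : S₀ = S₁₁ - S₁₂ * S₂₂⁻¹ * S₂₁)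
    (T₁ : Matrix (Fin p₁) (Fin p₁) ℝ) (hT₁ : T₁ = Matrix.diagonal t₁)
    (T₂ : Matrix (Fin p₂) (Fin p₂) ℝ) (hT₂ : T₂ = Matrix.diagonal t₂)
    (h₀ : IsUnit (1 + S₀ * T₁).det) :
    (1 + Matrix.fromBlocks S₁₁ S₁₂ S₂₁ S₂₂ * Matrix.fromBlocks T₁ 0 0 T₂).det
      = (1 + S₀ * T₁).det * S₂₂.det *
        (S₂₂⁻¹ * S₂₁ * T₁ * (1 + S₀ * T₁)⁻¹ * S₁₂ * S₂₂⁻¹ + S₂₂⁻¹ + T₂).det := by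
  subst hS₀
  exact det_one_add_fromBlocks_mul_fromBlocks_diagonal S₁₁ S₁₂ S₂₁ S₂₂ T₁ T₂ hS₂₂ h₀
end

section
/- Let p ≥ 2, and let Σ be a real symmetric positive definite p × p matrix partitioned so that Σ₁₁ is the leading (p−1) × (p−1) block, σ ∈ ℝ^{p−1} is the last column of Σ restricted to the first p−1 rows (so Σ₁₂ = σ, Σ₂₁ = σᵀ), and the (p,p) entry of Σ equals 1. Set Σ₀ = Σ₁₁ − σσᵀ. Then for every real α > 0 and every t ∈ ℝ^p with all coordinates t_j ≥ 0, writing T₁ = diag(t_1,…,t_{p−1}), one has det(I_p + Σ·diag(t_1,…,t_p))^{−α} = Γ(α)⁻¹ ∫₀^∞ det(I_{p−1} + Σ₀T₁)^{−α} · exp(−y · σᵀ T₁ (I_{p−1} + Σ₀T₁)⁻¹ σ) · y^{α−1} e^{−(1+t_p) y} dy. -/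
open MeasureTheory Matrix

/-- If `A` is positive semidefinite and `d` is nonnegative, then `det (1 + A * diagonal d)` is
positive, although `A * diagonal d` need not be symmetric. -/
theorem Matrix.PosSemidef.det_one_add_mul_diagonal_pos {m : Type*} [Fintype m] [DecidableEq m]
    {A : Matrix m m ℝ} (hA : A.PosSemidef) {d : m → ℝ} (hd : ∀ j, 0 ≤ d j) :
    0 < (1 + A * diagonal d).det := by
  have hsq : diagonal d = diagonal (fun j => √(d j)) * diagonal fun j => √(d j) := by
    rw [diagonal_mul_diagonal]
    exact congrArg diagonal (funext fun j => (Real.mul_self_sqrt (hd j)).symm)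
  rw [hsq, ← Matrix.mul_assoc, det_one_add_mul_comm, ← Matrix.mul_assoc]
  have h := hA.mul_mul_conjTranspose_same (diagonal fun j => √(d j))
  rw [diagonal_conjTranspose, star_trivial] at h
  exact (PosDef.one.add_posSemidef h).det_pos

/-- Schur complement form of `det (1 + S * diagonal t)` for a block matrix `S` whose lower right
entry is `1`. -/
theorem det_one_add_fromBlocks_mul_diagonal {m : Type*} [Fintype m] [DecidableEq m]
    (B : Matrix m m ℝ) (v : m → ℝ) (t : m ⊕ Unit → ℝ)
    (h : IsUnit (1 + (B - vecMulVec v v) * diagonal (t ∘ Sum.inl)).det) :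
    (1 + fromBlocks B (of fun i (_ : Unit) => v i) (of fun (_ : Unit) j => v j) 1 *
        diagonal t).det =
      (1 + (B - vecMulVec v v) * diagonal (t ∘ Sum.inl)).det *
        (1 + t (Sum.inr ()) + v ⬝ᵥ (diagonal (t ∘ Sum.inl) *
          (1 + (B - vecMulVec v v) * diagonal (t ∘ Sum.inl))⁻¹) *ᵥ v) := by
  set T := diagonal (t ∘ Sum.inl) with hT
  set A := 1 + (B - vecMulVec v v) * T with hA
  let := invertibleOfIsUnitDet A h
  set c : Matrix m Unit ℝ := of fun i _ => v i with hc
  set r : Matrix Unit m ℝ := of fun _ j => v j with hr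
  set U : Matrix Unit Unit ℝ := diagonal (t ∘ Sum.inr) with hU
  have ht : diagonal t = fromBlocks T 0 0 U := by
    rw [hT, hU, fromBlocks_diagonal, Sum.elim_comp_inl_inr]
  have hcr : vecMulVec v v = c * r := by
    ext i j
    simp [hc, hr, vecMulVec_apply, mul_apply]
  have hfac : 1 + fromBlocks B c r 1 * diagonal t =
      fromBlocks 1 c 0 1 * fromBlocks A (-c) (r * T) (1 + U) := by
    rw [ht, ← fromBlocks_one, fromBlocks_multiply, fromBlocks_multiply, fromBlocks_add, hA, hcr]
    congr 1 <;> simp [Matrix.sub_mul, Matrix.mul_add, Matrix.mul_assoc]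
    abel
  rw [hfac, det_mul, det_fromBlocks_zero₂₁, det_one, det_one, one_mul, one_mul, det_fromBlocks₁₁,
    invOf_eq_nonsing_inv, Matrix.mul_neg, sub_neg_eq_add,
    det_unique (n := Unit), Matrix.mul_assoc r, Matrix.mul_assoc r]
  rfl

/-- Special case `p₂ = 1` of Theorem 1, in Laplace-transform form: the `p`-variate
gamma Laplace transform is a gamma mixture of non-central Laplace transforms. -/
theorem laplace_transform_gamma_mixture (n : ℕ) (hn : 1 ≤ n)
    (S₁₁ : Matrix (Fin n) (Fin n) ℝ) (v : Fin n → ℝ)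
    (S : Matrix (Fin n ⊕ Unit) (Fin n ⊕ Unit) ℝ)
    (hS : S = Matrix.fromBlocks S₁₁ (Matrix.of fun i (_ : Unit) => v i)
        (Matrix.of fun (_ : Unit) j => v j) 1)
    (hSpos : S.PosDef)
    (S₀ : Matrix (Fin n) (Fin n) ℝ) (hS₀ : S₀ = S₁₁ - Matrix.vecMulVec v v)
    (α : ℝ) (hα : 0 < α) (t : Fin n ⊕ Unit → ℝ) (ht : ∀ j, 0 ≤ t j) :
    (1 + S * Matrix.diagonal t).det ^ (-α)
      = (Real.Gamma α)⁻¹ *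
        ∫ y in Set.Ioi (0 : ℝ),
          (1 + S₀ * Matrix.diagonal (t ∘ Sum.inl)).det ^ (-α) *
          Real.exp (-(y * (v ⬝ᵥ (Matrix.diagonal (t ∘ Sum.inl) *
            (1 + S₀ * Matrix.diagonal (t ∘ Sum.inl))⁻¹) *ᵥ v))) *
          y ^ (α - 1) * Real.exp (-((1 + t (Sum.inr ())) * y)) := by
  subst hS hS₀
  have hcr : of (fun i (_ : Unit) => v i) * ((1 : Matrix Unit Unit ℝ)⁻¹) *
      (of fun i (_ : Unit) => v i)ᴴ = vecMulVec v v := by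
    ext i j
    simp [vecMulVec_apply, mul_apply]
  have hS₀ : (S₁₁ - vecMulVec v v).PosSemidef := by
    rw [← hcr]
    let : Invertible (1 : Matrix Unit Unit ℝ) := invertibleOne
    refine (PosDef.fromBlocks₂₂ S₁₁ _ PosDef.one).1 ?_
    exact hSpos.posSemidef
  have hA : 0 < (1 + (S₁₁ - vecMulVec v v) * diagonal (t ∘ Sum.inl)).det :=
    hS₀.det_one_add_mul_diagonal_pos fun j => ht (Sum.inl j)
  have hdet := det_one_add_fromBlocks_mul_diagonal S₁₁ v t hA.ne'.isUnit
  have hpos := hSpos.posSemidef.det_one_add_mul_diagonal_pos ht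
  rw [hdet] at hpos ⊢
  have hq := pos_of_mul_pos_right hpos hA.le
  set a := (1 + (S₁₁ - vecMulVec v v) * diagonal (t ∘ Sum.inl)).det
  set q := v ⬝ᵥ (diagonal (t ∘ Sum.inl) *
    (1 + (S₁₁ - vecMulVec v v) * diagonal (t ∘ Sum.inl))⁻¹) *ᵥ v
  have hint (y : ℝ) : a ^ (-α) * Real.exp (-(y * q)) * y ^ (α - 1) *
      Real.exp (-((1 + t (Sum.inr ())) * y)) =
      a ^ (-α) * (y ^ (α - 1) * Real.exp (-((1 + t (Sum.inr ()) + q) * y))) := by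
    rw [show -((1 + t (Sum.inr ()) + q) * y) = -(y * q) + -((1 + t (Sum.inr ())) * y) by ring,
      Real.exp_add]
    ring
  simp_rw [hint]
  rw [integral_const_mul, Real.integral_rpow_mul_exp_neg_mul_Ioi hα hq,
    Real.mul_rpow hA.le hq.le, one_div, Real.inv_rpow hq.le, ← Real.rpow_neg hq.le]
  field_simp [(Real.Gamma_pos_of_pos hα).ne']
end
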